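/- arXiv:1610.03654 — 4 statements merged into one kernel-verified Lean document; each statement's English description precedes it below -/
import Mathlib

section
/- Let p > 0 be a real number, let q ≥ 2 be an integer, and let f(x₁,x₂) = x₂^q + e^{-1/|x₁|^p} (extended by f(0,x₂) = x₂^q, since e^{-1/|x₁|^p} → 0 as x₁ → 0). Then for every smooth compactly supported function φ : ℝ² → ℝ, the limit lim_{t→∞} t^{1/q} (log t)^{1/p} · ∫_{ℝ²} e^{i t f(x₁,x₂)} φ(x₁,x₂) dx₁ dx₂ equals C_q · φ(0,0), where C_q = 4 Γ(1/q + 1) e^{iπ/(2q)} if q is even and C_q = 4 Γ(1/q + 1) cos(π/(2q)) if q is odd. -/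
open MeasureTheory Filter

/-- The phase `f(x₁,x₂) = x₂^q + e^{-1/|x₁|^p}`, extended by `f(0,x₂) = x₂^q`. -/
noncomputable def phase (p : ℝ) (q : ℕ) (x : ℝ × ℝ) : ℝ :=
  x.2 ^ q + (if x.1 = 0 then 0 else Real.exp (-1 / |x.1| ^ p))

/-- The constant `C_q`. -/
noncomputable def Cq (q : ℕ) : ℂ :=
  if Even q then
    ((4 * Real.Gamma (1 / (q : ℝ) + 1) : ℝ) : ℂ) *
      Complex.exp (((Real.pi / (2 * (q : ℝ)) : ℝ) : ℂ) * Complex.I)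
  else
    ((4 * Real.Gamma (1 / (q : ℝ) + 1) * Real.cos (Real.pi / (2 * (q : ℝ))) : ℝ) : ℂ)

open Topology Set

lemma integral_mul_eq_neg_integral_mul_deriv {E e : ℝ → ℂ} (hE : ∀ x, HasDerivAt E (e x) x)
    (he : Continuous e) {ψ ψ' : ℝ → ℝ} (hψ : ∀ x, HasDerivAt ψ (ψ' x) x)
    (hψc : HasCompactSupport ψ) (hψ' : Continuous ψ') (hψ'c : HasCompactSupport ψ') :
    ∫ x, e x * (ψ x : ℂ) = -∫ x, E x * (ψ' x : ℂ) := by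
  have hEc : Continuous E := continuous_iff_continuousAt.2 fun x => (hE x).continuousAt
  have hψ0 : Continuous ψ := continuous_iff_continuousAt.2 fun x => (hψ x).continuousAt
  have hint : ∀ (u : ℝ → ℂ) (v : ℝ → ℝ), Continuous u → Continuous v → HasCompactSupport v →
      Integrable (u * fun x => (v x : ℂ)) := by
    intro u v hu hv hvc
    have : HasCompactSupport (fun x => (v x : ℂ)) := hvc.comp_left Complex.ofReal_zero
    exact (hu.mul (Complex.continuous_ofReal.comp hv)).integrable_of_hasCompactSupport
      this.mul_left
  have := integral_mul_deriv_eq_deriv_mul_of_integrable (u := E) (u' := e)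
    (v := fun x => (ψ x : ℂ)) (v' := fun x => (ψ' x : ℂ)) (fun x _ => hE x)
    (fun x _ => (hψ x).ofReal_comp) (hint _ _ hEc hψ' hψ'c) (hint _ _ he hψ0 hψc)
    (hint _ _ hEc hψ0 hψc)
  rw [this, neg_neg]

/-- The mixed second partial derivative `∂₁∂₂φ`. -/
noncomputable def mixedDeriv (φ : ℝ × ℝ → ℝ) (z : ℝ × ℝ) : ℝ :=
  fderiv ℝ (fun w => fderiv ℝ φ w (0, 1)) z (1, 0)

section MixedDeriv

variable {φ : ℝ × ℝ → ℝ}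

lemma hasDerivAt_comp_prodMk_right (hφ : Differentiable ℝ φ) (x y : ℝ) :
    HasDerivAt (fun y => φ (x, y)) (fderiv ℝ φ (x, y) (0, 1)) y :=
  (hφ (x, y)).hasFDerivAt.comp_hasDerivAt y ((hasDerivAt_const y x).prodMk (hasDerivAt_id y))

lemma hasDerivAt_comp_prodMk_left (hφ : Differentiable ℝ φ) (x y : ℝ) :
    HasDerivAt (fun x => φ (x, y)) (fderiv ℝ φ (x, y) (1, 0)) x :=
  (hφ (x, y)).hasFDerivAt.comp_hasDerivAt x ((hasDerivAt_id x).prodMk (hasDerivAt_const x y))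

lemma HasCompactSupport.comp_prodMk_right (hφc : HasCompactSupport φ) (x : ℝ) :
    HasCompactSupport fun y => φ (x, y) :=
  hφc.comp_isClosedEmbedding (Function.LeftInverse.isClosedEmbedding (f := Prod.snd)
    (fun _ => rfl) continuous_snd (by fun_prop))

lemma HasCompactSupport.comp_prodMk_left (hφc : HasCompactSupport φ) (y : ℝ) :
    HasCompactSupport fun x => φ (x, y) :=
  hφc.comp_isClosedEmbedding (Function.LeftInverse.isClosedEmbedding (f := Prod.fst)
    (fun _ => rfl) continuous_fst (by fun_prop))

lemma contDiff_fderiv_apply_const (hφ : ContDiff ℝ (⊤ : ℕ∞) φ) (v : ℝ × ℝ) :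
    ContDiff ℝ (⊤ : ℕ∞) fun z => fderiv ℝ φ z v :=
  (hφ.fderiv_right (m := (⊤ : ℕ∞)) (by simp)).clm_apply contDiff_const

lemma continuous_mixedDeriv (hφ : ContDiff ℝ (⊤ : ℕ∞) φ) : Continuous (mixedDeriv φ) :=
  (contDiff_fderiv_apply_const (contDiff_fderiv_apply_const hφ _) _).continuous

lemma HasCompactSupport.mixedDeriv (hφc : HasCompactSupport φ) :
    HasCompactSupport (mixedDeriv φ) :=
  (hφc.fderiv_apply ℝ (0, 1)).fderiv_apply ℝ (1, 0)

lemma integrable_mul_mul_ofReal {u v : ℝ → ℂ} (hu : Continuous u) (hv : Continuous v)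
    (hφ : Continuous φ) (hφc : HasCompactSupport φ) :
    Integrable fun z : ℝ × ℝ => u z.1 * v z.2 * (φ z : ℂ) := by
  have : HasCompactSupport (fun x => (φ x : ℂ)) := hφc.comp_left Complex.ofReal_zero
  exact Continuous.integrable_of_hasCompactSupport (by fun_prop) this.mul_left

lemma integral_mul_mul_eq_integral_mixedDeriv (hφ : ContDiff ℝ (⊤ : ℕ∞) φ)
    (hφc : HasCompactSupport φ) {E₁ e₁ E₂ e₂ : ℝ → ℂ} (hE₁ : ∀ x, HasDerivAt E₁ (e₁ x) x)
    (he₁ : Continuous e₁) (hE₂ : ∀ x, HasDerivAt E₂ (e₂ x) x) (he₂ : Continuous e₂) :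
    ∫ z : ℝ × ℝ, e₁ z.1 * e₂ z.2 * (φ z : ℂ) =
      ∫ z : ℝ × ℝ, E₁ z.1 * E₂ z.2 * (mixedDeriv φ z : ℂ) := by
  have hE₁c : Continuous E₁ := continuous_iff_continuousAt.2 fun x => (hE₁ x).continuousAt
  have hE₂c : Continuous E₂ := continuous_iff_continuousAt.2 fun x => (hE₂ x).continuousAt
  have hφ₂ := contDiff_fderiv_apply_const hφ (0, 1)
  have hφ₂c := hφc.fderiv_apply ℝ (0, 1)
  have hmc := continuous_mixedDeriv hφ
  have hd : Differentiable ℝ φ := hφ.differentiable (by simp)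
  have hd₂ := hφ₂.differentiable (by simp)
  calc ∫ z : ℝ × ℝ, e₁ z.1 * e₂ z.2 * (φ z : ℂ)
      = ∫ x, ∫ y, e₁ x * e₂ y * (φ (x, y) : ℂ) := by
        rw [Measure.volume_eq_prod, integral_prod _
          (integrable_mul_mul_ofReal he₁ he₂ hφ.continuous hφc)]
    _ = -∫ x, ∫ y, e₁ x * E₂ y * (fderiv ℝ φ (x, y) (0, 1) : ℂ) := by
        rw [← integral_neg]
        congr 1 with x
        simp_rw [mul_assoc]
        rw [integral_const_mul, integral_const_mul, ← mul_neg,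
          integral_mul_eq_neg_integral_mul_deriv hE₂ he₂
            (fun y => hasDerivAt_comp_prodMk_right hd x y) (hφc.comp_prodMk_right x)
            (by exact hφ₂.continuous.comp (by fun_prop)) (hφ₂c.comp_prodMk_right x)]
    _ = -∫ y, ∫ x, e₁ x * E₂ y * (fderiv ℝ φ (x, y) (0, 1) : ℂ) := by
        rw [integral_integral_swap]
        exact integrable_mul_mul_ofReal he₁ hE₂c hφ₂.continuous hφ₂c
    _ = ∫ y, ∫ x, E₁ x * E₂ y * (mixedDeriv φ (x, y) : ℂ) := by
        rw [← integral_neg]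
        congr 1 with y
        have h₁ : ∀ (u : ℝ → ℂ) (v : ℝ → ℝ),
            ∫ x, u x * E₂ y * (v x : ℂ) = E₂ y * ∫ x, u x * (v x : ℂ) := by
          intro u v
          rw [← integral_const_mul]
          congr 1 with x
          ring
        rw [h₁ e₁ fun x => fderiv ℝ φ (x, y) (0, 1), h₁ E₁ fun x => mixedDeriv φ (x, y),
          ← mul_neg, integral_mul_eq_neg_integral_mul_deriv hE₁ he₁
            (fun x => hasDerivAt_comp_prodMk_left hd₂ x y) (hφ₂c.comp_prodMk_left y)
            (by exact hmc.comp (by fun_prop)) (hφc.mixedDeriv.comp_prodMk_left y), neg_neg]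
        rfl
    _ = ∫ z : ℝ × ℝ, E₁ z.1 * E₂ z.2 * (mixedDeriv φ z : ℂ) := by
        rw [Measure.volume_eq_prod, integral_prod_symm _
          (integrable_mul_mul_ofReal hE₁c hE₂c hmc hφc.mixedDeriv)]

/-- The function equal to `a` on `(0, ∞)`, to `-b` on `(-∞, 0)` and to `0` at `0`. -/
noncomputable def jump (a b : ℂ) (x : ℝ) : ℂ :=
  if 0 < x then a else if x < 0 then -b else 0

lemma measurable_jump (a b : ℂ) : Measurable (jump a b) :=
  Measurable.ite measurableSet_Ioi measurable_const
    (Measurable.ite measurableSet_Iio measurable_const measurable_const)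

lemma norm_jump_le (a b : ℂ) (x : ℝ) : ‖jump a b x‖ ≤ ‖a‖ + ‖b‖ := by
  unfold jump
  split_ifs <;> simp
  positivity

lemma integral_jump_mul (a b : ℂ) {ψ ψ' : ℝ → ℝ} (hψ : ∀ x, HasDerivAt ψ (ψ' x) x)
    (hψc : HasCompactSupport ψ) (hψ' : Continuous ψ') (hψ'c : HasCompactSupport ψ') :
    ∫ x, jump a b x * (ψ' x : ℂ) = -((a + b) * (ψ 0 : ℂ)) := by
  have hd : deriv ψ = ψ' := funext fun x => (hψ x).deriv
  have hc : ContDiff ℝ 1 ψ :=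
    contDiff_one_iff_deriv.2 ⟨fun x => (hψ x).differentiableAt, hd ▸ hψ'⟩
  have hi : Integrable (fun x => (ψ' x : ℂ)) := (hψ'.integrable_of_hasCompactSupport hψ'c).ofReal
  have hint : Integrable (fun x => jump a b x * (ψ' x : ℂ)) :=
    hi.bdd_mul (measurable_jump a b).aestronglyMeasurable (ae_of_all _ (norm_jump_le a b))
  rw [← integral_add_compl (measurableSet_Iic (a := (0 : ℝ))) hint, compl_Iic,
    setIntegral_congr_fun (s := Ioi (0 : ℝ)) (g := fun x => a * (ψ' x : ℂ)) measurableSet_Ioi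
      (fun x hx => by simp only [jump, if_pos (mem_Ioi.1 hx)]),
    integral_Iic_eq_integral_Iio,
    setIntegral_congr_fun (s := Iio (0 : ℝ)) (g := fun x => -b * (ψ' x : ℂ)) measurableSet_Iio
      (fun x hx => by
        simp only [jump, if_pos (mem_Iio.1 hx), if_neg (not_lt.2 (mem_Iio.1 hx).le)]),
    integral_const_mul, integral_const_mul, ← integral_Iic_eq_integral_Iio,
    integral_complex_ofReal, integral_complex_ofReal, ← hd, hψc.integral_Ioi_deriv_eq hc,
    hψc.integral_Iic_deriv_eq hc]
  push_cast
  ring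

lemma integral_jump_mul_jump_mul_mixedDeriv (hφ : ContDiff ℝ (⊤ : ℕ∞) φ)
    (hφc : HasCompactSupport φ) (a₁ b₁ a₂ b₂ : ℂ) :
    ∫ z : ℝ × ℝ, jump a₁ b₁ z.1 * jump a₂ b₂ z.2 * (mixedDeriv φ z : ℂ) =
      (a₁ + b₁) * (a₂ + b₂) * (φ (0, 0) : ℂ) := by
  have hφ₂ := contDiff_fderiv_apply_const hφ (0, 1)
  have hφ₂c := hφc.fderiv_apply ℝ (0, 1)
  have hmc := continuous_mixedDeriv hφ
  have hd : Differentiable ℝ φ := hφ.differentiable (by simp)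
  have hd₂ := hφ₂.differentiable (by simp)
  have hi : Integrable (fun z => (mixedDeriv φ z : ℂ)) :=
    (hmc.integrable_of_hasCompactSupport hφc.mixedDeriv).ofReal
  have hint : Integrable
      (fun z : ℝ × ℝ => jump a₁ b₁ z.1 * jump a₂ b₂ z.2 * (mixedDeriv φ z : ℂ)) := by
    refine hi.bdd_mul (c := (‖a₁‖ + ‖b₁‖) * (‖a₂‖ + ‖b₂‖))
      (((measurable_jump a₁ b₁).comp measurable_fst).mul
        ((measurable_jump a₂ b₂).comp measurable_snd)).aestronglyMeasurable
      (ae_of_all _ fun z => ?_)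
    rw [norm_mul]
    gcongr <;> exact norm_jump_le _ _ _
  rw [Measure.volume_eq_prod] at hint ⊢
  rw [integral_prod_symm _ hint]
  have h₁ : ∀ y, ∫ x, jump a₁ b₁ x * jump a₂ b₂ y * (mixedDeriv φ (x, y) : ℂ) =
      -(a₁ + b₁) * (jump a₂ b₂ y * (fderiv ℝ φ (0, y) (0, 1) : ℂ)) := by
    intro y
    have := integral_jump_mul a₁ b₁ (fun x => hasDerivAt_comp_prodMk_left hd₂ x y)
      (hφ₂c.comp_prodMk_left y) (by exact hmc.comp (by fun_prop))
      (hφc.mixedDeriv.comp_prodMk_left y)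
    rw [mul_left_comm, neg_mul, ← this, ← integral_const_mul]
    congr 1 with x
    rw [mixedDeriv]
    ring
  simp_rw [h₁]
  rw [integral_const_mul, integral_jump_mul a₂ b₂
    (fun y => hasDerivAt_comp_prodMk_right hd 0 y) (hφc.comp_prodMk_right 0)
    (by exact hφ₂.continuous.comp (by fun_prop)) (hφ₂c.comp_prodMk_right 0)]
  ring

/-- If `N t * E t` converges pointwise and locally boundedly to a jump function in each variable,
the product oscillatory integral localizes at the origin. -/
lemma tendsto_integral_of_tendsto_jump (hφ : ContDiff ℝ (⊤ : ℕ∞) φ)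
    (hφc : HasCompactSupport φ) {N₁ N₂ : ℝ → ℂ} {E₁ e₁ E₂ e₂ : ℝ → ℝ → ℂ}
    (hE₁ : ∀ t x, HasDerivAt (E₁ t) (e₁ t x) x) (he₁ : ∀ t, Continuous (e₁ t))
    (hE₂ : ∀ t x, HasDerivAt (E₂ t) (e₂ t x) x) (he₂ : ∀ t, Continuous (e₂ t))
    {a₁ b₁ a₂ b₂ : ℂ}
    (hb₁ : ∀ R, ∃ C, ∀ᶠ t in atTop, ∀ x, |x| ≤ R → ‖N₁ t * E₁ t x‖ ≤ C)
    (hb₂ : ∀ R, ∃ C, ∀ᶠ t in atTop, ∀ x, |x| ≤ R → ‖N₂ t * E₂ t x‖ ≤ C)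
    (hl₁ : ∀ x, Tendsto (fun t => N₁ t * E₁ t x) atTop (𝓝 (jump a₁ b₁ x)))
    (hl₂ : ∀ x, Tendsto (fun t => N₂ t * E₂ t x) atTop (𝓝 (jump a₂ b₂ x))) :
    Tendsto (fun t => N₁ t * N₂ t * ∫ z : ℝ × ℝ, e₁ t z.1 * e₂ t z.2 * (φ z : ℂ)) atTop
      (𝓝 ((a₁ + b₁) * (a₂ + b₂) * (φ (0, 0) : ℂ))) := by
  have hmc := continuous_mixedDeriv hφ
  have hE₁c : ∀ t, Continuous (E₁ t) := fun t =>
    continuous_iff_continuousAt.2 fun x => (hE₁ t x).continuousAt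
  have hE₂c : ∀ t, Continuous (E₂ t) := fun t =>
    continuous_iff_continuousAt.2 fun x => (hE₂ t x).continuousAt
  have hi : Integrable (fun z => ‖mixedDeriv φ z‖) :=
    (hmc.integrable_of_hasCompactSupport hφc.mixedDeriv).norm
  obtain ⟨R, hR⟩ : ∃ R, ∀ z, mixedDeriv φ z ≠ 0 → ‖z‖ ≤ R := by
    obtain ⟨R, hR⟩ := hφc.mixedDeriv.isCompact.isBounded.exists_norm_le
    exact ⟨R, fun z hz => hR z (subset_tsupport _ hz)⟩
  obtain ⟨C₁, hC₁⟩ := hb₁ R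
  obtain ⟨C₂, hC₂⟩ := hb₂ R
  simp_rw [fun t => integral_mul_mul_eq_integral_mixedDeriv hφ hφc (hE₁ t) (he₁ t) (hE₂ t) (he₂ t),
    ← integral_const_mul, ← integral_jump_mul_jump_mul_mixedDeriv hφ hφc]
  refine tendsto_integral_filter_of_dominated_convergence
    (fun z => C₁ * C₂ * ‖mixedDeriv φ z‖) (Eventually.of_forall fun t => ?_) ?_
    (hi.const_mul _) (ae_of_all _ fun z => ?_)
  · exact Continuous.aestronglyMeasurable (by have := hE₁c t; have := hE₂c t; fun_prop)
  · filter_upwards [hC₁, hC₂] with t h₁ h₂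
    refine ae_of_all _ fun z => ?_
    by_cases hz : mixedDeriv φ z = 0
    · simp [hz]
    · have hz' := hR z hz
      have k₁ := h₁ z.1 ((norm_fst_le z).trans hz')
      have k₂ := h₂ z.2 ((norm_snd_le z).trans hz')
      calc ‖N₁ t * N₂ t * (E₁ t z.1 * E₂ t z.2 * (mixedDeriv φ z : ℂ))‖
          = ‖N₁ t * E₁ t z.1‖ * ‖N₂ t * E₂ t z.2‖ * ‖mixedDeriv φ z‖ := by
            simp only [norm_mul, Complex.norm_real]
            ring
        _ ≤ C₁ * C₂ * ‖mixedDeriv φ z‖ := by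
            have := (norm_nonneg _).trans k₁
            gcongr
  · have := ((hl₁ z.1).mul (hl₂ z.2)).mul_const (mixedDeriv φ z : ℂ)
    refine this.congr fun t => ?_
    ring

end MixedDeriv

/-- Integration by parts for an oscillatory integral whose phase `θ` has derivative `w⁻¹`. -/
lemma integral_cexp_I_mul_eq {θ θ' w w' : ℝ → ℝ} {a b : ℝ}
    (hθ : ∀ x ∈ uIcc a b, HasDerivAt θ (θ' x) x) (hw : ∀ x ∈ uIcc a b, HasDerivAt w (w' x) x)
    (hθ' : ContinuousOn θ' (uIcc a b)) (hw' : ContinuousOn w' (uIcc a b))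
    (h : ∀ x ∈ uIcc a b, w x * θ' x = 1) :
    ∫ x in a..b, Complex.exp (Complex.I * (θ x : ℂ)) =
      -Complex.I * ((w b : ℂ) * Complex.exp (Complex.I * (θ b : ℂ)) -
        (w a : ℂ) * Complex.exp (Complex.I * (θ a : ℂ)) -
        ∫ x in a..b, (w' x : ℂ) * Complex.exp (Complex.I * (θ x : ℂ))) := by
  have hθc : ContinuousOn θ (uIcc a b) := fun x hx => (hθ x hx).continuousAt.continuousWithinAt
  have hexp : ∀ x ∈ uIcc a b, HasDerivAt (fun x => Complex.exp (Complex.I * (θ x : ℂ)))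
      (Complex.exp (Complex.I * (θ x : ℂ)) * (Complex.I * (θ' x : ℂ))) x :=
    fun x hx => ((hθ x hx).ofReal_comp.const_mul Complex.I).cexp
  have hcont : ContinuousOn (fun x => Complex.exp (Complex.I * (θ x : ℂ)) *
      (Complex.I * (θ' x : ℂ))) (uIcc a b) := by fun_prop
  rw [← intervalIntegral.integral_mul_deriv_eq_deriv_mul (u := fun x => (w x : ℂ))
    (u' := fun x => (w' x : ℂ)) (v := fun x => Complex.exp (Complex.I * (θ x : ℂ)))
    (fun x hx => (hw x hx).ofReal_comp) hexp
    (ContinuousOn.intervalIntegrable (by fun_prop)) hcont.intervalIntegrable,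
    ← intervalIntegral.integral_const_mul]
  refine intervalIntegral.integral_congr fun x hx => ?_
  have : (w x : ℂ) * (θ' x : ℂ) = 1 := by exact_mod_cast h x hx
  linear_combination Complex.exp (Complex.I * (θ x : ℂ)) * Complex.I ^ 2 * this +
    Complex.exp (Complex.I * (θ x : ℂ)) * Complex.I_sq

/-- The incomplete Fresnel-type integral `∫₀ᵘ exp(i s^q) ds`. -/
noncomputable def fresnel (q : ℕ) (u : ℝ) : ℂ :=
  ∫ s in (0 : ℝ)..u, Complex.exp (Complex.I * ((s ^ q : ℝ) : ℂ))

section Fresnel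

variable {q : ℕ}

lemma hasDerivAt_fresnel (q : ℕ) (u : ℝ) :
    HasDerivAt (fresnel q) (Complex.exp (Complex.I * ((u ^ q : ℝ) : ℂ))) u :=
  (by fun_prop : Continuous fun s : ℝ => Complex.exp (Complex.I * ((s ^ q : ℝ) : ℂ)))
    |>.integral_hasStrictDerivAt 0 u |>.hasDerivAt

lemma continuous_fresnel (q : ℕ) : Continuous (fresnel q) :=
  continuous_iff_continuousAt.2 fun u => (hasDerivAt_fresnel q u).continuousAt

lemma norm_cexp_I_mul_ofReal (x : ℝ) : ‖Complex.exp (Complex.I * (x : ℂ))‖ = 1 := by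
  rw [mul_comm, Complex.norm_exp_ofReal_mul_I]

lemma exists_tendsto_fresnel (hq : 2 ≤ q) : ∃ c, Tendsto (fresnel q) atTop (𝓝 c) := by
  obtain ⟨m, rfl⟩ : ∃ m, q = m + 2 := ⟨q - 2, by omega⟩
  set θ : ℝ → ℝ := fun s => s ^ (m + 2)
  set w : ℝ → ℝ := fun s => (s ^ (m + 1))⁻¹ / (m + 2)
  set w' : ℝ → ℝ := fun s => -((m + 1) / (m + 2) * (s ^ (m + 2))⁻¹)
  have hpos : ∀ {u : ℝ}, 1 ≤ u → ∀ x ∈ uIcc 1 u, 0 < x := fun hu x hx => by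
    rw [uIcc_of_le hu] at hx
    linarith [hx.1]
  have key : ∀ u : ℝ, 1 ≤ u → fresnel (m + 2) u = fresnel (m + 2) 1 +
      -Complex.I * ((w u : ℂ) * Complex.exp (Complex.I * (θ u : ℂ)) -
        (w 1 : ℂ) * Complex.exp (Complex.I * (θ 1 : ℂ)) -
        ∫ x in (1 : ℝ)..u, (w' x : ℂ) * Complex.exp (Complex.I * (θ x : ℂ))) := by
    intro u hu
    have hc : Continuous fun s : ℝ => Complex.exp (Complex.I * ((s ^ (m + 2) : ℝ) : ℂ)) := by
      fun_prop
    rw [fresnel, fresnel, ← intervalIntegral.integral_add_adjacent_intervals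
      (hc.intervalIntegrable 0 1) (hc.intervalIntegrable 1 u)]
    congr 1
    refine integral_cexp_I_mul_eq (θ' := fun s => (m + 2) * s ^ (m + 1)) (fun x hx => ?_)
      (fun x hx => ?_) (by fun_prop) ?_ (fun x hx => ?_)
    · simpa using hasDerivAt_pow (m + 2) x
    · have hx := hpos hu x hx
      have := ((hasDerivAt_pow (m + 1) x).inv (by positivity)).div_const ((m : ℝ) + 2)
      refine this.congr_deriv ?_
      simp only [w']
      push_cast
      field_simp
      simp [pow_succ]
      ring
    · intro x hx
      have hx := hpos hu x hx
      have : x ^ (m + 2) ≠ 0 := by positivity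
      exact ContinuousAt.continuousWithinAt (by fun_prop (disch := assumption))
    · have hx := hpos hu x hx
      simp only [w]
      field_simp
  have hw : Tendsto w atTop (𝓝 0) := by
    have := ((tendsto_pow_atTop (α := ℝ) (n := m + 1) (by omega)).inv_tendsto_atTop).div_const
      ((m : ℝ) + 2)
    simpa using this
  have hwθ : Tendsto (fun u => (w u : ℂ) * Complex.exp (Complex.I * (θ u : ℂ))) atTop (𝓝 0) := by
    rw [tendsto_zero_iff_norm_tendsto_zero]
    simpa [norm_cexp_I_mul_ofReal] using hw.norm
  have hint : IntegrableOn (fun x => (w' x : ℂ) * Complex.exp (Complex.I * (θ x : ℂ)))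
      (Ioi 1) := by
    have h₁ : IntegrableOn (fun x : ℝ => x ^ (-((m + 2 : ℕ) : ℝ))) (Ioi 1) :=
      integrableOn_Ioi_rpow_of_lt (by push_cast; linarith [Nat.cast_nonneg (α := ℝ) m]) one_pos
    have h₂ : IntegrableOn w' (Ioi 1) := by
      refine IntegrableOn.congr_fun (h₁.const_mul (-((m + 1) / (m + 2)))) (fun x hx => ?_)
        measurableSet_Ioi
      have : (0 : ℝ) < x := one_pos.trans hx
      simp only [w', neg_mul, Real.rpow_neg this.le, Real.rpow_natCast]
    refine (Integrable.ofReal h₂).mul_bdd (c := 1) (Continuous.aestronglyMeasurable (by fun_prop))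
      (ae_of_all _ fun x => (norm_cexp_I_mul_ofReal _).le)
  refine ⟨_, Tendsto.congr' (EventuallyEq.symm ((eventually_ge_atTop 1).mono key))
    (((hwθ.sub_const _).sub (intervalIntegral_tendsto_integral_Ioi 1 hint tendsto_id)).const_mul _
      |>.const_add _)⟩

lemma fresnel_neg_of_even (hq : Even q) (u : ℝ) : fresnel q (-u) = -fresnel q u := by
  rw [fresnel, fresnel, ← intervalIntegral.integral_symm, ← neg_zero,
    ← intervalIntegral.integral_comp_neg]
  simp [hq.neg_pow]

lemma fresnel_neg_of_odd (hq : Odd q) (u : ℝ) :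
    fresnel q (-u) = -starRingEnd ℂ (fresnel q u) := by
  rw [fresnel, fresnel, ← intervalIntegral.intervalIntegral_conj, ← intervalIntegral.integral_symm, ← neg_zero,
    ← intervalIntegral.integral_comp_neg]
  simp [hq.neg_pow, ← Complex.exp_conj]

lemma norm_fresnel_neg (q : ℕ) (u : ℝ) : ‖fresnel q (-u)‖ = ‖fresnel q u‖ := by
  rcases q.even_or_odd with h | h
  · rw [fresnel_neg_of_even h, norm_neg]
  · rw [fresnel_neg_of_odd h, norm_neg, RCLike.norm_conj]

lemma exists_norm_fresnel_le (hq : 2 ≤ q) : ∃ C, ∀ u, ‖fresnel q u‖ ≤ C := by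
  obtain ⟨c, hc⟩ := exists_tendsto_fresnel hq
  obtain ⟨U, hU⟩ := eventually_atTop.1 (hc.norm.eventually_le_const (lt_add_one ‖c‖))
  obtain ⟨D, hD⟩ := (isCompact_Icc (a := 0) (b := U)).exists_bound_of_continuousOn
    (continuous_fresnel q).continuousOn
  have h : ∀ u, 0 ≤ u → ‖fresnel q u‖ ≤ max D (‖c‖ + 1) := fun u hu => by
    rcases le_total u U with h | h
    · exact (hD u ⟨hu, h⟩).trans (le_max_left _ _)
    · exact (hU u h).trans (le_max_right _ _)
  refine ⟨max D (‖c‖ + 1), fun u => ?_⟩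
  rcases le_total 0 u with hu | hu
  · exact h u hu
  · rw [← norm_fresnel_neg]
    exact h _ (by linarith)

end Fresnel

section FresnelLimit

variable {q : ℕ}

lemma integrableOn_pow_mul_exp_neg_pow (hq : 0 < q) (k : ℕ) :
    IntegrableOn (fun r : ℝ => r ^ k * Real.exp (-r ^ q)) (Ioi 0) := by
  have hk : (-1 : ℝ) < k := by linarith [Nat.cast_nonneg (α := ℝ) k]
  simpa using integrableOn_rpow_mul_exp_neg_rpow hk (Nat.cast_pos.2 hq)

/-- The kernel `exp(-(1 - i s) r^q)`. -/
noncomputable def expKernel (q : ℕ) (s r : ℝ) : ℂ :=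
  Complex.exp (-((1 - Complex.I * s) * ((r ^ q : ℝ) : ℂ)))

lemma norm_expKernel (q : ℕ) (s r : ℝ) : ‖expKernel q s r‖ = Real.exp (-r ^ q) := by
  rw [expKernel, Complex.norm_exp]
  simp [-Complex.ofReal_pow]

lemma continuous_expKernel (q : ℕ) (s : ℝ) : Continuous (expKernel q s) := by
  unfold expKernel
  fun_prop

lemma integrableOn_pow_mul_expKernel (hq : 0 < q) (k : ℕ) (s : ℝ) :
    IntegrableOn (fun r : ℝ => ((r ^ k : ℝ) : ℂ) * expKernel q s r) (Ioi 0) := by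
  refine (integrableOn_pow_mul_exp_neg_pow hq k).mono' ?_ ?_
  · have := continuous_expKernel q s
    exact Continuous.aestronglyMeasurable (by fun_prop)
  · refine (ae_restrict_mem measurableSet_Ioi).mono fun r hr => ?_
    have hr : 0 < r := hr
    rw [norm_mul, norm_expKernel, Complex.norm_real, Real.norm_of_nonneg (by positivity)]

lemma integral_expKernel (hq : 0 < q) (s : ℝ) :
    ∫ r in Ioi (0 : ℝ), expKernel q s r =
      q * (1 - Complex.I * s) * ∫ r in Ioi (0 : ℝ), ((r ^ q : ℝ) : ℂ) * expKernel q s r := by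
  have h0 := integrableOn_pow_mul_expKernel hq 0 s
  simp only [pow_zero, Complex.ofReal_one, one_mul] at h0
  have h1 := (integrableOn_pow_mul_expKernel hq q s).const_mul (q * (1 - Complex.I * s))
  have hd : ∀ r ∈ Ici (0 : ℝ), HasDerivAt (fun r : ℝ => (r : ℂ) * expKernel q s r)
      (expKernel q s r - q * (1 - Complex.I * s) * (((r ^ q : ℝ) : ℂ) * expKernel q s r)) r := by
    intro r _
    have h := (hasDerivAt_id r).ofReal_comp.mul
      ((((hasDerivAt_pow q r).ofReal_comp).const_mul (1 - Complex.I * (s : ℂ))).neg.cexp)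
    refine h.congr_deriv ?_
    obtain ⟨m, rfl⟩ : ∃ m, q = m + 1 := ⟨q - 1, by omega⟩
    simp only [expKernel, id, Pi.neg_apply, Nat.add_sub_cancel]
    push_cast
    ring
  have hlim : Tendsto (fun r : ℝ => (r : ℂ) * expKernel q s r) atTop (𝓝 0) := by
    rw [tendsto_zero_iff_norm_tendsto_zero]
    have : Tendsto (fun r : ℝ => r * Real.exp (-r)) atTop (𝓝 0) := by
      simpa using Real.tendsto_pow_mul_exp_neg_atTop_nhds_zero 1
    refine squeeze_zero' (Eventually.of_forall fun _ => norm_nonneg _) ?_ this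
    filter_upwards [eventually_ge_atTop 1] with r hr
    rw [norm_mul, norm_expKernel, Complex.norm_real, Real.norm_of_nonneg (by linarith)]
    gcongr
    exact le_self_pow₀ hr hq.ne'
  have := integral_Ioi_of_hasDerivAt_of_tendsto' hd (h0.sub h1) hlim
  rw [integral_sub h0 h1, integral_const_mul] at this
  rw [← sub_eq_zero, this]
  simp

lemma hasDerivAt_integral_expKernel (hq : 0 < q) (s : ℝ) :
    HasDerivAt (fun s => ∫ r in Ioi (0 : ℝ), expKernel q s r)
      (Complex.I * ∫ r in Ioi (0 : ℝ), ((r ^ q : ℝ) : ℂ) * expKernel q s r) s := by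
  rw [← integral_const_mul]
  have h0 := integrableOn_pow_mul_expKernel hq 0 s
  simp only [pow_zero, Complex.ofReal_one, one_mul] at h0
  refine (hasDerivAt_integral_of_dominated_loc_of_deriv_le (s := univ)
    (F' := fun s r => Complex.I * (((r ^ q : ℝ) : ℂ) * expKernel q s r))
    (bound := fun r => r ^ q * Real.exp (-r ^ q)) univ_mem
    (Eventually.of_forall fun s => (continuous_expKernel q s).aestronglyMeasurable) h0
    ((integrableOn_pow_mul_expKernel hq q s).const_mul _).aestronglyMeasurable ?_
    (integrableOn_pow_mul_exp_neg_pow hq q) (ae_of_all _ fun r s _ => ?_)).2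
  · refine (ae_restrict_mem measurableSet_Ioi).mono fun r hr s _ => ?_
    have hr : 0 < r := hr
    rw [norm_mul, norm_mul, norm_expKernel, Complex.norm_I, one_mul, Complex.norm_real,
      Real.norm_of_nonneg (by positivity)]
  · have h := (((((hasDerivAt_id s).ofReal_comp).const_mul Complex.I).const_sub 1).mul_const
      ((r ^ q : ℝ) : ℂ)).neg.cexp
    refine h.congr_deriv ?_
    simp only [expKernel, id, Pi.neg_apply]
    push_cast
    ring

lemma one_sub_I_mul_mem_slitPlane (s : ℝ) : 1 - Complex.I * (s : ℂ) ∈ Complex.slitPlane :=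
  Or.inl (by simp)

lemma cpow_mul_integral_expKernel (hq : 0 < q) (s : ℝ) :
    (1 - Complex.I * (s : ℂ)) ^ (1 / (q : ℂ)) * ∫ r in Ioi (0 : ℝ), expKernel q s r =
      (Real.Gamma (1 / (q : ℝ) + 1) : ℂ) := by
  have hq' : (q : ℂ) ≠ 0 := Nat.cast_ne_zero.2 hq.ne'
  have hd : ∀ s : ℝ, HasDerivAt (fun s : ℝ => (1 - Complex.I * (s : ℂ)) ^ (1 / (q : ℂ)) *
      ∫ r in Ioi (0 : ℝ), expKernel q s r) 0 s := by
    intro s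
    have hb := Complex.slitPlane_ne_zero (one_sub_I_mul_mem_slitPlane s)
    have h := (((hasDerivAt_id (1 - Complex.I * (s : ℂ))).cpow_const (c := 1 / (q : ℂ))
      (one_sub_I_mul_mem_slitPlane s))).comp s
      (((hasDerivAt_id s).ofReal_comp.const_mul Complex.I).const_sub 1)
    refine (h.mul (hasDerivAt_integral_expKernel hq s)).congr_deriv ?_
    rw [integral_expKernel hq s]
    simp only [id, Function.comp_apply]
    rw [Complex.cpow_sub _ _ hb, Complex.cpow_one]
    push_cast
    field_simp
    ring
  have hconst := is_const_of_deriv_eq_zero (fun s => (hd s).differentiableAt)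
    (fun s => (hd s).deriv) s 0
  rw [hconst]
  have h0 : ∫ r in Ioi (0 : ℝ), expKernel q 0 r =
      ((∫ r in Ioi (0 : ℝ), Real.exp (-r ^ (q : ℝ)) : ℝ) : ℂ) := by
    rw [← integral_complex_ofReal]
    simp [expKernel]
  rw [h0, integral_exp_neg_rpow (by positivity)]
  simp

lemma integral_mul_fresnel_comp_mul (hq : 2 ≤ q) (l : ℝ) :
    ∫ r in Ioi (0 : ℝ), ((q * (r ^ (q - 1) * Real.exp (-r ^ q)) : ℝ) : ℂ) * fresnel q (l * r) =
      l * ∫ r in Ioi (0 : ℝ), expKernel q (l ^ q) r := by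
  obtain ⟨C, hC⟩ := exists_norm_fresnel_le hq
  have hF := continuous_fresnel q
  set u : ℝ → ℂ := fun r => ((Real.exp (-r ^ q) : ℝ) : ℂ)
  set u' : ℝ → ℂ := fun r => -((q * (r ^ (q - 1) * Real.exp (-r ^ q)) : ℝ) : ℂ)
  set v : ℝ → ℂ := fun r => fresnel q (l * r)
  set v' : ℝ → ℂ := fun r => l * Complex.exp (Complex.I * (((l * r) ^ q : ℝ) : ℂ))
  have huv : ∀ r, u r * v' r = l * expKernel q (l ^ q) r := by
    intro r
    simp only [u, v', expKernel]
    rw [Complex.ofReal_exp, mul_left_comm, ← Complex.exp_add]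
    congr 2
    push_cast
    ring
  have hu : ∀ r ∈ Ioi (0 : ℝ), HasDerivAt u (u' r) r := by
    intro r _
    refine (hasDerivAt_pow q r).neg.exp.ofReal_comp.congr_deriv ?_
    simp only [u', Pi.neg_apply]
    push_cast
    ring
  have hv : ∀ r ∈ Ioi (0 : ℝ), HasDerivAt v (v' r) r := by
    intro r _
    have := (hasDerivAt_fresnel q (l * r)).scomp r ((hasDerivAt_id r).const_mul l)
    refine this.congr_deriv ?_
    simp [v']
  have h0 := integrableOn_pow_mul_expKernel (by omega : 0 < q) 0 (l ^ q)
  simp only [pow_zero, Complex.ofReal_one, one_mul] at h0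
  have huv' : IntegrableOn (u * v') (Ioi 0) := by
    have : u * v' = fun r => l * expKernel q (l ^ q) r := funext huv
    rw [this]
    exact h0.const_mul _
  have hu'v : IntegrableOn (u' * v) (Ioi 0) := by
    have : IntegrableOn u' (Ioi 0) :=
      (Integrable.ofReal ((integrableOn_pow_mul_exp_neg_pow (by omega) (q - 1)).const_mul
        (q : ℝ))).neg
    exact Integrable.mul_bdd (c := C) this
      (Continuous.aestronglyMeasurable (by fun_prop)) (ae_of_all _ fun r => hC _)
  have hz : Tendsto (u * v) (𝓝[>] 0) (𝓝 0) := by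
    have : Continuous (u * v) := by
      refine Continuous.mul ?_ ?_ <;> fun_prop
    have h := this.tendsto 0
    simp only [Pi.mul_apply, v, mul_zero, fresnel, intervalIntegral.integral_same] at h
    exact h.mono_left nhdsWithin_le_nhds
  have hi : Tendsto (u * v) atTop (𝓝 0) := by
    have hu0 : Tendsto u atTop (𝓝 0) := by
      rw [← Complex.ofReal_zero]
      exact (Complex.continuous_ofReal.tendsto 0).comp
        (Real.tendsto_exp_neg_atTop_nhds_zero.comp (tendsto_pow_atTop (by omega)))
    exact hu0.zero_mul_isBoundedUnder_le
      (isBoundedUnder_of ⟨C, fun r => hC _⟩)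
  have := integral_Ioi_mul_deriv_eq_deriv_mul hu hv huv' hu'v hz hi
  simp_rw [huv] at this
  rw [integral_const_mul] at this
  rw [this, sub_zero, zero_sub, ← integral_neg]
  simp only [u', neg_mul, neg_neg, v]

lemma integral_pow_mul_exp_neg_pow (hq : 0 < q) :
    ∫ r in Ioi (0 : ℝ), q * (r ^ (q - 1) * Real.exp (-r ^ q)) = 1 := by
  have h := integral_rpow_mul_exp_neg_rpow (p := q) (q := ((q - 1 : ℕ) : ℝ)) (by positivity)
    (by linarith [Nat.cast_nonneg (α := ℝ) (q - 1)])
  simp only [Real.rpow_natCast] at h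
  have hq' : (q : ℝ) ≠ 0 := by positivity
  rw [integral_const_mul, h, Nat.cast_sub hq, Nat.cast_one, sub_add_cancel, div_self hq',
    Real.Gamma_one]
  field_simp

lemma tendsto_mul_integral_expKernel (hq : 0 < q) :
    Tendsto (fun l : ℝ => l * ∫ r in Ioi (0 : ℝ), expKernel q (l ^ q) r) atTop
      (𝓝 ((Real.Gamma (1 / (q : ℝ) + 1) : ℂ) *
        Complex.exp (((Real.pi / (2 * (q : ℝ)) : ℝ) : ℂ) * Complex.I))) := by
  have hq' : (q : ℂ) ≠ 0 := Nat.cast_ne_zero.2 hq.ne'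
  have hlim : Tendsto (fun l : ℝ => (Real.Gamma (1 / (q : ℝ) + 1) : ℂ) *
      Complex.exp (-(1 / (q : ℂ)) * Complex.log ((((l ^ q)⁻¹ : ℝ) : ℂ) - Complex.I))) atTop
      (𝓝 ((Real.Gamma (1 / (q : ℝ) + 1) : ℂ) *
        Complex.exp (-(1 / (q : ℂ)) * Complex.log (((0 : ℝ) : ℂ) - Complex.I)))) := by
    have h1 : Tendsto (fun l : ℝ => (((l ^ q)⁻¹ : ℝ) : ℂ) - Complex.I) atTop
        (𝓝 (((0 : ℝ) : ℂ) - Complex.I)) :=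
      ((Complex.continuous_ofReal.tendsto 0).comp
        (tendsto_pow_atTop hq.ne').inv_tendsto_atTop).sub_const _
    have h2 : ((0 : ℝ) : ℂ) - Complex.I ∈ Complex.slitPlane := Or.inr (by simp)
    exact (((h1.clog h2).const_mul _).cexp).const_mul _
  have hval : Complex.exp (-(1 / (q : ℂ)) * Complex.log (((0 : ℝ) : ℂ) - Complex.I)) =
      Complex.exp (((Real.pi / (2 * (q : ℝ)) : ℝ) : ℂ) * Complex.I) := by
    rw [Complex.ofReal_zero, zero_sub, Complex.log_neg_I]
    congr 1
    push_cast
    field_simp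
  rw [hval] at hlim
  refine hlim.congr' ?_
  filter_upwards [eventually_gt_atTop 0] with l hl
  have hb := Complex.slitPlane_ne_zero (one_sub_I_mul_mem_slitPlane (l ^ q))
  have hw : (((l ^ q)⁻¹ : ℝ) : ℂ) - Complex.I ≠ 0 := fun h => by
    simpa only [Complex.sub_im, Complex.ofReal_im, Complex.I_im, zero_sub, Complex.zero_im,
      neg_eq_zero, one_ne_zero] using congrArg Complex.im h
  have hfac : 1 - Complex.I * ((l ^ q : ℝ) : ℂ) =
      ((l ^ q : ℝ) : ℂ) * ((((l ^ q)⁻¹ : ℝ) : ℂ) - Complex.I) := by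
    have : ((l ^ q : ℝ) : ℂ) ≠ 0 := Complex.ofReal_ne_zero.2 (by positivity)
    rw [Complex.ofReal_inv, mul_sub, mul_inv_cancel₀ this, mul_comm]
  rw [← cpow_mul_integral_expKernel hq (l ^ q), Complex.cpow_def_of_ne_zero hb,
    mul_right_comm, ← Complex.exp_add, hfac, Complex.log_ofReal_mul (by positivity) hw,
    Real.log_pow]
  congr 1
  rw [show (((q : ℝ) * Real.log l : ℝ) + Complex.log ((((l ^ q)⁻¹ : ℝ) : ℂ) - Complex.I)) *
    (1 / (q : ℂ)) + -(1 / (q : ℂ)) * Complex.log ((((l ^ q)⁻¹ : ℝ) : ℂ) - Complex.I) =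
    ((Real.log l : ℝ) : ℂ) by push_cast; field_simp; ring, ← Complex.ofReal_exp,
    Real.exp_log hl]

lemma tendsto_fresnel_atTop (hq : 2 ≤ q) :
    Tendsto (fresnel q) atTop (𝓝 ((Real.Gamma (1 / (q : ℝ) + 1) : ℂ) *
      Complex.exp (((Real.pi / (2 * (q : ℝ)) : ℝ) : ℂ) * Complex.I))) := by
  obtain ⟨c, hc⟩ := exists_tendsto_fresnel hq
  obtain ⟨C, hC⟩ := exists_norm_fresnel_le hq
  have hF := continuous_fresnel q
  have hi := (integrableOn_pow_mul_exp_neg_pow (by omega : 0 < q) (q - 1)).const_mul (q : ℝ)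
  have hlim : Tendsto (fun l : ℝ => ∫ r in Ioi (0 : ℝ),
      ((q * (r ^ (q - 1) * Real.exp (-r ^ q)) : ℝ) : ℂ) * fresnel q (l * r)) atTop
      (𝓝 (∫ r in Ioi (0 : ℝ), ((q * (r ^ (q - 1) * Real.exp (-r ^ q)) : ℝ) : ℂ) * c)) := by
    refine tendsto_integral_filter_of_dominated_convergence _
      (Eventually.of_forall fun l => Continuous.aestronglyMeasurable (by fun_prop))
      (Eventually.of_forall fun l => ae_of_all _ fun r => ?_) (hi.norm.mul_const C) ?_
    · rw [norm_mul, Complex.norm_real]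
      gcongr
      exact hC _
    · refine (ae_restrict_mem measurableSet_Ioi).mono fun r hr => ?_
      exact (hc.comp (tendsto_id.atTop_mul_const hr)).const_mul _
  rw [integral_mul_const, integral_complex_ofReal, integral_pow_mul_exp_neg_pow (by omega),
    Complex.ofReal_one, one_mul] at hlim
  simp_rw [integral_mul_fresnel_comp_mul hq] at hlim
  rwa [← tendsto_nhds_unique hlim (tendsto_mul_integral_expKernel (by omega))]

end FresnelLimit

section FlatPhase

variable {p : ℝ}

/-- The flat phase `exp(-1/|x|^p)`, extended by `0` at `0`. -/
noncomputable def flatPhase (p x : ℝ) : ℝ :=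
  if x = 0 then 0 else Real.exp (-1 / |x| ^ p)

lemma continuous_flatPhase (hp : 0 < p) : Continuous (flatPhase p) := by
  refine continuous_iff_continuousAt.2 fun x => ?_
  rcases eq_or_ne x 0 with rfl | hx
  · rw [continuousAt_iff_punctured_nhds]
    have h : Tendsto (fun x : ℝ => |x| ^ p) (𝓝[≠] 0) (𝓝[>] 0) := by
      refine tendsto_nhdsWithin_iff.2 ⟨?_, ?_⟩
      · have : Continuous fun x : ℝ => |x| ^ p := by
          fun_prop (disch := exact hp.le)
        have := this.tendsto 0
        rw [abs_zero, Real.zero_rpow hp.ne'] at this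
        exact this.mono_left nhdsWithin_le_nhds
      · filter_upwards [self_mem_nhdsWithin] with x hx
        exact Real.rpow_pos_of_pos (abs_pos.2 hx) p
    have h' := Real.tendsto_exp_neg_atTop_nhds_zero.comp (tendsto_inv_nhdsGT_zero.comp h)
    rw [show flatPhase p 0 = 0 by simp [flatPhase]]
    refine h'.congr' ?_
    filter_upwards [self_mem_nhdsWithin] with x hx
    have hx : x ≠ 0 := hx
    simp [flatPhase, hx, neg_div]
  · have h : ContinuousAt (fun x : ℝ => Real.exp (-1 / |x| ^ p)) x := by
      have : |x| ^ p ≠ 0 := (Real.rpow_pos_of_pos (abs_pos.2 hx) p).ne'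
      have h' : |x| ≠ 0 := (abs_pos.2 hx).ne'
      have := ContinuousAt.rpow_const (p := p) continuous_abs.continuousAt (Or.inl h')
      exact (continuousAt_const.div this ‹_›).rexp
    refine h.congr ?_
    filter_upwards [isOpen_ne.mem_nhds hx] with y hy
    rw [flatPhase, if_neg hy]

lemma flatPhase_neg (p x : ℝ) : flatPhase p (-x) = flatPhase p x := by
  simp [flatPhase]

/-- The antiderivative of `exp(i t flatPhase)` vanishing at the origin. -/
noncomputable def flatIntegral (p t x : ℝ) : ℂ :=
  ∫ s in (0 : ℝ)..x, Complex.exp (Complex.I * ((t * flatPhase p s : ℝ) : ℂ))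

lemma continuous_cexp_flatPhase (hp : 0 < p) (t : ℝ) :
    Continuous fun s => Complex.exp (Complex.I * ((t * flatPhase p s : ℝ) : ℂ)) := by
  have := continuous_flatPhase hp
  fun_prop

lemma hasDerivAt_flatIntegral (hp : 0 < p) (t x : ℝ) :
    HasDerivAt (flatIntegral p t) (Complex.exp (Complex.I * ((t * flatPhase p x : ℝ) : ℂ))) x :=
  ((continuous_cexp_flatPhase hp t).integral_hasStrictDerivAt 0 x).hasDerivAt

lemma flatIntegral_neg (p t x : ℝ) : flatIntegral p t (-x) = -flatIntegral p t x := by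
  rw [flatIntegral, flatIntegral, ← intervalIntegral.integral_symm, ← neg_zero,
    ← intervalIntegral.integral_comp_neg]
  simp [flatPhase_neg]

/-- The integrand of `flatIntegral` at `t = exp L` after rescaling space by `L^(1/p)`. -/
noncomputable def scaledIntegrand (p L r : ℝ) : ℂ :=
  Complex.exp (Complex.I * ((Real.exp (L * (1 - r ^ (-p))) : ℝ) : ℂ))

lemma norm_scaledIntegrand (p L r : ℝ) : ‖scaledIntegrand p L r‖ = 1 :=
  norm_cexp_I_mul_ofReal _

lemma measurable_scaledIntegrand (p L : ℝ) : Measurable (scaledIntegrand p L) := by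
  unfold scaledIntegrand
  fun_prop

lemma intervalIntegrable_scaledIntegrand (p L a b : ℝ) :
    IntervalIntegrable (scaledIntegrand p L) volume a b :=
  (intervalIntegrable_const (c := (1 : ℝ))).mono_fun
    (measurable_scaledIntegrand p L).aestronglyMeasurable
    (ae_of_all _ fun r => by simp [norm_scaledIntegrand])

lemma mul_flatIntegral_eq (hp : 0 < p) {L x : ℝ} (hL : 0 < L) (hx : 0 ≤ x) :
    ((L ^ (1 / p) : ℝ) : ℂ) * flatIntegral p (Real.exp L) x =
      ∫ r in (0 : ℝ)..(L ^ (1 / p) * x), scaledIntegrand p L r := by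
  have hN : 0 < L ^ (1 / p) := by positivity
  rw [flatIntegral, ← mul_zero (L ^ (1 / p)), ← intervalIntegral.smul_integral_comp_mul_left,
    mul_zero, Complex.real_smul]
  congr 1
  refine intervalIntegral.integral_congr_ae (ae_of_all _ fun s hs => ?_)
  rw [uIoc_of_le hx] at hs
  have hs0 : 0 < s := hs.1
  have hsp : (L ^ (1 / p) * s) ^ (-p) = L⁻¹ * (s ^ p)⁻¹ := by
    rw [Real.mul_rpow hN.le hs0.le, ← Real.rpow_mul hL.le, Real.rpow_neg hs0.le]
    congr 1
    rw [show 1 / p * -p = -1 by field_simp, Real.rpow_neg_one]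
  have hexp : L * (1 - L⁻¹ * (s ^ p)⁻¹) = L + -1 / s ^ p := by
    field_simp
    ring
  rw [scaledIntegrand, flatPhase, if_neg hs0.ne', abs_of_pos hs0, ← Real.exp_add, hsp, hexp]

lemma tendsto_integral_scaledIntegrand (hp : 0 < p) :
    Tendsto (fun L => ∫ r in (0 : ℝ)..1, scaledIntegrand p L r) atTop (𝓝 1) := by
  have h1 : (1 : ℂ) = ∫ r in (0 : ℝ)..1, (1 : ℂ) := by simp
  rw [h1]
  refine intervalIntegral.tendsto_integral_filter_of_dominated_convergence (fun _ => 1)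
    (Eventually.of_forall fun L => (measurable_scaledIntegrand p L).aestronglyMeasurable)
    (Eventually.of_forall fun L => ae_of_all _ fun r _ => (norm_scaledIntegrand p L r).le)
    intervalIntegrable_const ?_
  have hne : ∀ᵐ r : ℝ, r ≠ 1 := by simp [ae_iff]
  filter_upwards [hne] with r hr1 hr
  rw [uIoc_of_le zero_le_one] at hr
  have hlt : 1 - r ^ (-p) < 0 := by
    have := Real.one_lt_rpow_of_pos_of_lt_one_of_neg hr.1 (lt_of_le_of_ne hr.2 hr1)
      (neg_neg_of_pos hp)
    linarith
  have h : Tendsto (fun L : ℝ => Real.exp (L * (1 - r ^ (-p)))) atTop (𝓝 0) :=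
    Real.tendsto_exp_atBot.comp (tendsto_id.atTop_mul_const_of_neg hlt)
  have h' := ((Complex.continuous_ofReal.tendsto 0).comp h).const_mul Complex.I |>.cexp
  rw [Complex.ofReal_zero, mul_zero, Complex.exp_zero] at h'
  exact h'

/-- Beyond the transition point `r = 1`, the rescaled integral decays. -/
lemma exists_norm_integral_scaledIntegrand_le (hp : 0 < p) {a R : ℝ} (ha : 1 < a) (hR : 0 < R) :
    ∃ κ : ℝ → ℝ, Tendsto κ atTop (𝓝 0) ∧ ∀ L, 1 ≤ L → ∀ X, a ≤ X → X ≤ R * L ^ (1 / p) →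
      ‖∫ r in a..X, scaledIntegrand p L r‖ ≤ κ L := by
  set η := 1 - a ^ (-p)
  have hη : 0 < η := sub_pos.2 (Real.rpow_lt_one_of_one_lt_of_neg ha (neg_neg_of_pos hp))
  set K := 2 * (R ^ (p + 1) / p) + ((p + 1) / p * R ^ p + 1) * R
  refine ⟨fun L => L ^ (1 / p) * Real.exp (-η * L) * K, ?_, fun L hL X haX hX => ?_⟩
  · simpa using (tendsto_rpow_mul_exp_neg_mul_atTop_nhds_zero (1 / p) η hη).mul_const K
  have hL0 : 0 < L := by linarith
  set N := L ^ (1 / p)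
  have hN : 0 < N := by positivity
  have hNp : N ^ p = L := by
    rw [← Real.rpow_mul hL0.le, one_div_mul_cancel hp.ne', Real.rpow_one]
  have hpos : ∀ r ∈ uIcc a X, 0 < r := fun r hr => by
    rw [uIcc_of_le haX] at hr
    linarith [hr.1]
  set w : ℝ → ℝ := fun r => r ^ (p + 1) / (L * p) * Real.exp (-(L * (1 - r ^ (-p))))
  set w' : ℝ → ℝ := fun r => ((p + 1) / p * (r ^ p / L) - 1) *
    Real.exp (-(L * (1 - r ^ (-p))))
  have hexp : ∀ r ∈ uIcc a X, Real.exp (-(L * (1 - r ^ (-p)))) ≤ Real.exp (-η * L) := by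
    intro r hr
    rw [uIcc_of_le haX] at hr
    have : r ^ (-p) ≤ a ^ (-p) :=
      Real.rpow_le_rpow_of_nonpos (by linarith) hr.1 (by linarith)
    refine Real.exp_le_exp.2 ?_
    simp only [η]
    nlinarith
  have hrp : ∀ r ∈ uIcc a X, r ^ p / L ≤ R ^ p := by
    intro r hr
    have hr0 := hpos r hr
    rw [uIcc_of_le haX] at hr
    rw [div_le_iff₀ hL0, ← hNp, ← Real.mul_rpow hR.le hN.le]
    exact Real.rpow_le_rpow hr0.le (hr.2.trans hX) hp.le
  have hwb : ∀ r ∈ uIcc a X, |w r| ≤ R ^ (p + 1) / p * N * Real.exp (-η * L) := by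
    intro r hr
    have hr0 := hpos r hr
    have hrX : r ≤ R * N := by
      rw [uIcc_of_le haX] at hr
      exact hr.2.trans hX
    rw [abs_of_nonneg (by positivity)]
    have : r ^ (p + 1) / (L * p) ≤ R ^ (p + 1) / p * N := by
      rw [Real.rpow_add_one hr0.ne', Real.rpow_add_one hR.ne']
      calc r ^ p * r / (L * p) = (r ^ p / L) * r / p := by field_simp
        _ ≤ R ^ p * (R * N) / p := by
          have := hrp r hr
          gcongr
        _ = R ^ p * R / p * N := by ring
    exact mul_le_mul this (hexp r hr) (Real.exp_pos _).le (by positivity)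
  have hw'b : ∀ r ∈ uIcc a X, |w' r| ≤ ((p + 1) / p * R ^ p + 1) * Real.exp (-η * L) := by
    intro r hr
    have hr0 := hpos r hr
    rw [abs_mul, Real.abs_exp]
    refine mul_le_mul ?_ (hexp r hr) (Real.exp_pos _).le (by positivity)
    refine (abs_sub _ _).trans ?_
    rw [abs_one, abs_of_nonneg (by positivity)]
    have := hrp r hr
    gcongr
  have hcontp : ∀ c : ℝ, ContinuousOn (fun r : ℝ => r ^ c) (uIcc a X) := fun c =>
    ContinuousOn.rpow_const continuousOn_id fun r hr => Or.inl (hpos r hr).ne'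
  have hd : ∀ r ∈ uIcc a X, HasDerivAt (fun r : ℝ => L * (1 - r ^ (-p)))
      (L * p * r ^ (-p - 1)) r := by
    intro r hr
    refine ((((Real.hasDerivAt_rpow_const (p := -p)
      (Or.inl (hpos r hr).ne')).const_sub 1).const_mul L)).congr_deriv ?_
    ring
  have hid : ∀ r : ℝ, 0 < r → r ^ (p + 1) * r ^ (-p - 1) = 1 := by
    intro r hr
    rw [← Real.rpow_add hr]
    simp
  have key := integral_cexp_I_mul_eq (θ := fun r => Real.exp (L * (1 - r ^ (-p))))
    (θ' := fun r => Real.exp (L * (1 - r ^ (-p))) * (L * p * r ^ (-p - 1))) (w := w) (w' := w')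
    (a := a) (b := X) (fun r hr => (hd r hr).exp) (fun r hr => ?_) ?_ ?_ (fun r hr => ?_)
  rotate_left
  · have h := ((Real.hasDerivAt_rpow_const (p := p + 1) (Or.inl (hpos r hr).ne')).div_const
      (L * p)).mul (hd r hr).neg.exp
    refine h.congr_deriv ?_
    have := hid r (hpos r hr)
    simp only [w', Pi.neg_apply, add_sub_cancel_right]
    have h2 : r ^ (p + 1) / (L * p) * (L * p * r ^ (-p - 1)) = 1 := by
      field_simp
      exact this
    linear_combination (-Real.exp (-(L * (1 - r ^ (-p))))) * h2
  · have := hcontp (-p)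
    have := hcontp (-p - 1)
    fun_prop
  · have := hcontp (-p)
    have := hcontp p
    fun_prop
  · have := hid r (hpos r hr)
    simp only [w, Real.exp_neg]
    field_simp
    exact this
  have hI : ‖∫ r in a..X, (w' r : ℂ) *
      Complex.exp (Complex.I * ((Real.exp (L * (1 - r ^ (-p))) : ℝ) : ℂ))‖ ≤
      ((p + 1) / p * R ^ p + 1) * Real.exp (-η * L) * (R * N) := by
    refine (intervalIntegral.norm_integral_le_of_norm_le_const fun r hr => ?_).trans
      (mul_le_mul_of_nonneg_left (b := |X - a|) ?_ (by positivity))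
    · rw [norm_mul, norm_cexp_I_mul_ofReal, mul_one, Complex.norm_real]
      exact hw'b r (uIoc_subset_uIcc hr)
    · rw [abs_of_nonneg (by linarith)]
      linarith
  simp only [scaledIntegrand]
  rw [key, norm_mul, norm_neg, Complex.norm_I, one_mul]
  refine (norm_sub_le_of_le (norm_sub_le_of_le ?_ ?_) hI).trans_eq (b :=
    R ^ (p + 1) / p * N * Real.exp (-η * L) + R ^ (p + 1) / p * N * Real.exp (-η * L) +
      ((p + 1) / p * R ^ p + 1) * Real.exp (-η * L) * (R * N)) ?_
  · rw [norm_mul, norm_cexp_I_mul_ofReal, mul_one, Complex.norm_real]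
    exact hwb X right_mem_uIcc
  · rw [norm_mul, norm_cexp_I_mul_ofReal, mul_one, Complex.norm_real]
    exact hwb a left_mem_uIcc
  · simp only [K]
    ring

lemma norm_integral_scaledIntegrand_le (p L : ℝ) {a b : ℝ} (hab : a ≤ b) :
    ‖∫ r in a..b, scaledIntegrand p L r‖ ≤ b - a := by
  have := intervalIntegral.norm_integral_le_of_norm_le_const (a := a) (b := b)
    fun r _ => (norm_scaledIntegrand p L r).le
  rwa [one_mul, abs_of_nonneg (by linarith)] at this

lemma exists_norm_mul_flatIntegral_le (hp : 0 < p) (R : ℝ) :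
    ∃ C, ∀ᶠ t in atTop, ∀ x, |x| ≤ R →
      ‖((Real.log t ^ (1 / p) : ℝ) : ℂ) * flatIntegral p t x‖ ≤ C := by
  obtain ⟨κ, hκ, hb⟩ := exists_norm_integral_scaledIntegrand_le hp one_lt_two
    (lt_max_of_lt_right one_pos : 0 < max R 1)
  refine ⟨3, ?_⟩
  filter_upwards [Real.tendsto_log_atTop.eventually (hκ.eventually_le_const one_pos),
    Real.tendsto_log_atTop.eventually (eventually_ge_atTop 1), eventually_gt_atTop 0]
    with t h1 h2 h3
  have hnn : ∀ x, 0 ≤ x → x ≤ R →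
      ‖((Real.log t ^ (1 / p) : ℝ) : ℂ) * flatIntegral p t x‖ ≤ 3 := by
    intro x hx hxR
    have hN : 0 < Real.log t ^ (1 / p) := by positivity
    have heq := mul_flatIntegral_eq hp (L := Real.log t) (by linarith) hx
    rw [Real.exp_log h3] at heq
    rw [heq]
    rcases le_total (Real.log t ^ (1 / p) * x) 2 with h | h
    · refine (norm_integral_scaledIntegrand_le p _ (by positivity)).trans ?_
      linarith
    · rw [← intervalIntegral.integral_add_adjacent_intervals
        (intervalIntegrable_scaledIntegrand p _ 0 2) (intervalIntegrable_scaledIntegrand p _ 2 _)]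
      refine (norm_add_le_of_le (norm_integral_scaledIntegrand_le p _ zero_le_two)
        ((hb _ h2 _ h ?_).trans h1)).trans (by norm_num)
      rw [mul_comm]
      gcongr
      exact hxR.trans (le_max_left _ _)
  intro x hx
  rcases le_total 0 x with h | h
  · exact hnn x h (by rwa [abs_of_nonneg h] at hx)
  · have := hnn (-x) (by linarith) (by rwa [abs_of_nonpos h] at hx)
    rwa [flatIntegral_neg, mul_neg, norm_neg] at this

lemma tendsto_mul_flatIntegral_of_pos (hp : 0 < p) {x : ℝ} (hx : 0 < x) :
    Tendsto (fun t => ((Real.log t ^ (1 / p) : ℝ) : ℂ) * flatIntegral p t x) atTop (𝓝 1) := by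
  rw [Metric.tendsto_nhds]
  intro ε hε
  obtain ⟨κ, hκ, hb⟩ := exists_norm_integral_scaledIntegrand_le hp
    (by linarith : 1 < 1 + ε / 4) hx
  have h1 := Metric.tendsto_nhds.1 (tendsto_integral_scaledIntegrand hp) (ε / 4) (by linarith)
  have h2 := ((tendsto_rpow_atTop (by positivity : 0 < 1 / p)).atTop_mul_const hx).eventually
    (eventually_ge_atTop (1 + ε / 4))
  filter_upwards [Real.tendsto_log_atTop.eventually (hκ.eventually_le_const
    (by linarith : 0 < ε / 4)), Real.tendsto_log_atTop.eventually (eventually_ge_atTop 1),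
    Real.tendsto_log_atTop.eventually h1, Real.tendsto_log_atTop.eventually h2,
    eventually_gt_atTop 0] with t h1 h2 h3 h4 h5
  have heq := mul_flatIntegral_eq hp (L := Real.log t) (by linarith) hx.le
  rw [Real.exp_log h5] at heq
  have hii := intervalIntegrable_scaledIntegrand p (Real.log t)
  rw [heq, ← intervalIntegral.integral_add_adjacent_intervals (hii 0 1) (hii 1 _),
    ← intervalIntegral.integral_add_adjacent_intervals (hii 1 (1 + ε / 4)) (hii _ _),
    dist_eq_norm, add_sub_right_comm]
  rw [dist_eq_norm] at h3
  have k1 := norm_integral_scaledIntegrand_le p (Real.log t) (by linarith : 1 ≤ 1 + ε / 4)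
  have k2 := (hb _ h2 _ h4 (mul_comm _ _).le).trans h1
  refine (norm_add_le_of_le h3.le (norm_add_le_of_le k1 k2)).trans_lt ?_
  linarith

lemma tendsto_mul_flatIntegral (hp : 0 < p) (x : ℝ) :
    Tendsto (fun t => ((Real.log t ^ (1 / p) : ℝ) : ℂ) * flatIntegral p t x) atTop
      (𝓝 (jump 1 1 x)) := by
  rcases lt_trichotomy x 0 with h | rfl | h
  · have := (tendsto_mul_flatIntegral_of_pos hp (neg_pos.2 h)).neg
    simpa [jump, h, h.not_gt, flatIntegral_neg] using this
  · simp [jump, flatIntegral]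
  · simpa [jump, h] using tendsto_mul_flatIntegral_of_pos hp h

end FlatPhase

section PowerPhase

variable {q : ℕ}

/-- The antiderivative of `exp(i t y^q)` vanishing at the origin. -/
noncomputable def powIntegral (q : ℕ) (t y : ℝ) : ℂ :=
  ∫ s in (0 : ℝ)..y, Complex.exp (Complex.I * ((t * s ^ q : ℝ) : ℂ))

lemma hasDerivAt_powIntegral (q : ℕ) (t y : ℝ) :
    HasDerivAt (powIntegral q t) (Complex.exp (Complex.I * ((t * y ^ q : ℝ) : ℂ))) y :=
  (by fun_prop : Continuous fun s : ℝ => Complex.exp (Complex.I * ((t * s ^ q : ℝ) : ℂ)))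
    |>.integral_hasStrictDerivAt 0 y |>.hasDerivAt

lemma mul_powIntegral_eq (hq : q ≠ 0) {t : ℝ} (ht : 0 ≤ t) (y : ℝ) :
    ((t ^ (1 / (q : ℝ)) : ℝ) : ℂ) * powIntegral q t y = fresnel q (t ^ (1 / (q : ℝ)) * y) := by
  rw [powIntegral, fresnel, ← mul_zero (t ^ (1 / (q : ℝ))),
    ← intervalIntegral.smul_integral_comp_mul_left, mul_zero, Complex.real_smul]
  simp_rw [mul_pow, one_div, Real.rpow_inv_natCast_pow ht hq]

lemma tendsto_mul_powIntegral (hq : 2 ≤ q) (y : ℝ) :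
    Tendsto (fun t => ((t ^ (1 / (q : ℝ)) : ℝ) : ℂ) * powIntegral q t y) atTop
      (𝓝 (jump ((Real.Gamma (1 / (q : ℝ) + 1) : ℂ) *
          Complex.exp (((Real.pi / (2 * (q : ℝ)) : ℝ) : ℂ) * Complex.I))
        ((Real.Gamma (1 / (q : ℝ) + 1) : ℂ) * Complex.exp
          (((if Even q then 1 else -1) * (Real.pi / (2 * (q : ℝ))) : ℝ) * Complex.I)) y)) := by
  have hN : Tendsto (fun t : ℝ => t ^ (1 / (q : ℝ))) atTop atTop :=
    tendsto_rpow_atTop (by positivity)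
  have hev : ∀ᶠ t : ℝ in atTop, fresnel q (t ^ (1 / (q : ℝ)) * y) =
      ((t ^ (1 / (q : ℝ)) : ℝ) : ℂ) * powIntegral q t y :=
    (eventually_ge_atTop 0).mono fun t ht => (mul_powIntegral_eq (by omega) ht y).symm
  refine Tendsto.congr' hev ?_
  have hlim := tendsto_fresnel_atTop hq
  rcases lt_trichotomy y 0 with h | rfl | h
  · have hl := hlim.comp (hN.atTop_mul_const (neg_pos.2 h))
    rw [jump, if_neg h.not_gt, if_pos h]
    rcases q.even_or_odd with he | ho
    · rw [if_pos he, one_mul]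
      refine hl.neg.congr fun t => ?_
      rw [Function.comp_apply, mul_neg, fresnel_neg_of_even he, neg_neg]
    · rw [if_neg (Nat.not_even_iff_odd.2 ho)]
      have hl' := ((Complex.continuous_conj.tendsto _).comp hl).neg
      rw [map_mul, ← Complex.exp_conj, map_mul, Complex.conj_ofReal, Complex.conj_ofReal,
        Complex.conj_I] at hl'
      convert hl'.congr fun t => ?_ using 4
      · push_cast
        ring_nf
      · simp only [Function.comp_apply]
        rw [mul_neg, fresnel_neg_of_odd ho, map_neg, Complex.conj_conj, neg_neg]
  · simp [jump, fresnel]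
  · rw [jump, if_pos h]
    exact hlim.comp (hN.atTop_mul_const h)

end PowerPhase

theorem stmt0 (p : ℝ) (hp : 0 < p) (q : ℕ) (hq : 2 ≤ q)
    (φ : ℝ × ℝ → ℝ) (hφ : ContDiff ℝ (⊤ : ℕ∞) φ) (hφc : HasCompactSupport φ) :
    Tendsto (fun t : ℝ =>
        ((t ^ (1 / (q : ℝ)) * (Real.log t) ^ (1 / p) : ℝ) : ℂ) *
          ∫ x : ℝ × ℝ, Complex.exp (Complex.I * (t : ℂ) * ((phase p q x : ℝ) : ℂ)) *
            ((φ x : ℝ) : ℂ))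
      atTop (nhds (Cq q * ((φ (0, 0) : ℝ) : ℂ))) := by
  obtain ⟨C, hC⟩ := exists_norm_fresnel_le hq
  have h := tendsto_integral_of_tendsto_jump hφ hφc (hasDerivAt_flatIntegral hp)
    (continuous_cexp_flatPhase hp) (hasDerivAt_powIntegral q) (fun t => by fun_prop)
    (exists_norm_mul_flatIntegral_le hp)
    (fun R => ⟨C, (eventually_ge_atTop 0).mono fun t ht x _ => by
      rw [mul_powIntegral_eq (by omega) ht]
      exact hC _⟩)
    (tendsto_mul_flatIntegral hp) (tendsto_mul_powIntegral hq)
  convert h using 2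
  · rename_i t
    congr 1
    · push_cast
      ring
    · congr 1 with z
      rw [← Complex.exp_add]
      congr 2
      simp only [phase, flatPhase]
      push_cast
      ring
  · congr 1
    rw [Cq]
    split_ifs with he
    · push_cast
      rw [one_mul]
      ring
    · push_cast
      rw [Complex.cos]
      simp only [neg_mul, one_mul]
      ring
end

section
/- Let p > 0 be a real number, let q ≥ 2 be an integer, and let ε ∈ {+1, −1}. For every smooth compactly supported function φ : ℝ² → ℝ, define Ĩ^{(ε)}(t) = ∫₀^∞ ∫₀^∞ e^{i t (ε x₂^q + e^{-1/x₁^p})} φ(x₁,x₂) dx₁ dx₂ for t > 0. Then lim_{t→∞} t^{1/q} (log t)^{1/p} · Ĩ^{(ε)}(t) = Γ(1/q + 1) · e^{ε iπ/(2q)} · φ(0,0). -/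
open MeasureTheory Filter

/-- First-order integration by parts for the phase `exp (-1 / x ^ p)` away from the origin. -/
theorem exists_norm_integral_flat_phase_tail_le (p : ℝ) (hp : 0 < p) (M : ℝ) (hM : 0 < M) :
    ∃ C : ℝ, 0 ≤ C ∧ ∀ t : ℝ, 0 < t → ∀ a : ℝ, 0 < a → ∀ K : ℝ, 0 ≤ K → ∀ ψ : ℝ → ℂ,
      ContDiff ℝ 1 ψ → (∀ x, ‖ψ x‖ ≤ K) → (∀ x, ‖deriv ψ x‖ ≤ K) → (∀ x, M ≤ x → ψ x = 0) →
      ‖∫ x in Set.Ioi a, Complex.exp (Complex.I * t * (Real.exp (-1 / x ^ p) : ℝ)) * ψ x‖ ≤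
        C * K * Real.exp (1 / a ^ p) / t := by
  set D : ℝ := (M ^ (p + 1) + ((p + 1) * M ^ p + p)) / p with hD
  have hD0 : 0 ≤ D := by positivity
  refine ⟨M ^ (p + 1) / p + D * M, by positivity, ?_⟩
  intro t ht a ha K hK ψ hψ h0 h1 hMψ
  have hrhs : 0 ≤ (M ^ (p + 1) / p + D * M) * K * Real.exp (1 / a ^ p) / t := by positivity
  rcases le_total M a with hMa | haM
  · rw [setIntegral_eq_zero_of_forall_eq_zero]
    · simpa using hrhs
    · intro x hx
      rw [hMψ x (hMa.trans (le_of_lt hx)), mul_zero]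
  have hsplit : ∫ x in Set.Ioi a, Complex.exp (Complex.I * t * (Real.exp (-1 / x ^ p) : ℝ)) * ψ x
      = ∫ x in a..M, Complex.exp (Complex.I * t * (Real.exp (-1 / x ^ p) : ℝ)) * ψ x := by
    rw [intervalIntegral.integral_of_le haM]
    apply setIntegral_eq_of_subset_of_forall_sdiff_eq_zero measurableSet_Ioi
      Set.Ioc_subset_Ioi_self
    intro x hx
    have : M ≤ x := by
      by_contra h
      exact hx.2 ⟨hx.1, (not_le.mp h).le⟩
    rw [hMψ x this, mul_zero]
  rw [hsplit]
  set g : ℝ → ℝ := fun x => x ^ (p + 1) * Real.exp (1 / x ^ p) / p with hg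
  set g' : ℝ → ℝ := fun x => ((p + 1) * x ^ p - p) * Real.exp (1 / x ^ p) / p with hg'
  set w : ℝ → ℂ := fun x => Complex.exp (Complex.I * t * (Real.exp (-1 / x ^ p) : ℝ)) with hw
  have hwn : ∀ x, ‖w x‖ = 1 := by
    intro x
    have : Complex.I * t * (Real.exp (-1 / x ^ p) : ℝ)
      = Complex.I * ((t * Real.exp (-1 / x ^ p) : ℝ) : ℂ) := by push_cast; ring
    rw [hw]; simp only [this]; exact Complex.norm_exp_I_mul_ofReal _
  have hI : Set.uIcc a M = Set.Icc a M := Set.uIcc_of_le haM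
  have hgd : ∀ x, 0 < x → HasDerivAt g (g' x) x := by
    intro x hx
    have e1 : HasDerivAt (fun x : ℝ => x ^ (p + 1)) ((p + 1) * x ^ p) x := by
      simpa using Real.hasDerivAt_rpow_const (x := x) (p := p + 1) (Or.inl hx.ne')
    have e2 : HasDerivAt (fun x : ℝ => x ^ p) (p * x ^ (p - 1)) x :=
      Real.hasDerivAt_rpow_const (Or.inl hx.ne')
    have hxp : 0 < x ^ p := Real.rpow_pos_of_pos hx p
    have e3 := (e2.fun_inv hxp.ne').exp
    have e4 := (e1.fun_mul e3).div_const p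
    have hgf : g = fun y => y ^ (p + 1) * Real.exp (y ^ p)⁻¹ / p := by
      funext y; simp only [hg, one_div]
    rw [hgf]
    refine e4.congr_deriv ?_
    simp only [hg', one_div]
    rw [Real.rpow_add_one hx.ne', Real.rpow_sub_one hx.ne']
    field_simp
    ring
  have hwd : ∀ x, 0 < x → HasDerivAt w (w x * (Complex.I * t / (g x : ℝ))) x := by
    intro x hx
    have e2 : HasDerivAt (fun x : ℝ => x ^ p) (p * x ^ (p - 1)) x :=
      Real.hasDerivAt_rpow_const (Or.inl hx.ne')
    have hxp : 0 < x ^ p := Real.rpow_pos_of_pos hx p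
    have e3 : HasDerivAt (fun x : ℝ => Real.exp (-1 / x ^ p)) (1 / g x) x := by
      have e4 := (e2.fun_inv hxp.ne').fun_neg.exp
      have hf : (fun y : ℝ => Real.exp (-1 / y ^ p)) = fun y => Real.exp (-(y ^ p)⁻¹) := by
        funext y; rw [neg_div, one_div]
      rw [hf]
      refine e4.congr_deriv ?_
      simp only [hg]
      rw [Real.rpow_add_one hx.ne', Real.rpow_sub_one hx.ne', Real.exp_neg, one_div (x ^ p)]
      field_simp
    have := (e3.ofReal_comp.const_mul (Complex.I * t)).cexp
    refine this.congr_deriv ?_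
    simp only [hw]; push_cast; ring
  have hgpos : ∀ x, 0 < x → 0 < g x := fun x hx => by
    simp only [hg]; positivity
  have hψd : ∀ x, HasDerivAt ψ (deriv ψ x) x :=
    fun x => (hψ.differentiable (by norm_num) x).hasDerivAt
  have hposI : ∀ x ∈ Set.uIcc a M, 0 < x := fun x hx => by
    rw [hI] at hx; exact ha.trans_le hx.1
  have hgc : ContinuousOn g (Set.uIcc a M) := fun x hx =>
    (hgd x (hposI x hx)).continuousAt.continuousWithinAt
  have hwc : ContinuousOn w (Set.uIcc a M) := fun x hx =>
    (hwd x (hposI x hx)).continuousAt.continuousWithinAt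
  have hg'c : ContinuousOn g' (Set.uIcc a M) := by
    intro x hx
    have hx0 := hposI x hx
    have hxp : x ^ p ≠ 0 := (Real.rpow_pos_of_pos hx0 p).ne'
    have e2 : ContinuousAt (fun x : ℝ => x ^ p) x :=
      Real.continuousAt_rpow_const _ _ (Or.inl hx0.ne')
    apply ContinuousAt.continuousWithinAt
    exact (((e2.const_mul (p + 1)).sub continuousAt_const).mul
      ((continuousAt_const.div e2 hxp).rexp)).div_const p
  set u : ℝ → ℂ := fun x => ψ x * (g x : ℝ) with hu
  set u' : ℝ → ℂ := fun x => deriv ψ x * (g x : ℝ) + ψ x * (g' x : ℝ) with hu'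
  have hud : ∀ x ∈ Set.uIcc a M, HasDerivAt u (u' x) x := fun x hx =>
    (hψd x).mul (hgd x (hposI x hx)).ofReal_comp
  have hu'c : ContinuousOn u' (Set.uIcc a M) :=
    (((hψ.continuous_deriv (by norm_num)).continuousOn).mul
      (Complex.continuous_ofReal.comp_continuousOn hgc)).add
      (hψ.continuous.continuousOn.mul (Complex.continuous_ofReal.comp_continuousOn hg'c))
  have hparts := intervalIntegral.integral_mul_deriv_eq_deriv_mul hud
    (fun x hx => hwd x (hposI x hx)) hu'c.intervalIntegrable
    (ContinuousOn.intervalIntegrable (hwc.mul (continuousOn_const.div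
      (Complex.continuous_ofReal.comp_continuousOn hgc)
      (fun x hx => by exact_mod_cast (hgpos x (hposI x hx)).ne'))))
  have hlhs : ∫ x in a..M, u x * (w x * (Complex.I * t / (g x : ℝ)))
      = (Complex.I * t) * ∫ x in a..M, w x * ψ x := by
    rw [← intervalIntegral.integral_const_mul]
    apply intervalIntegral.integral_congr
    intro x hx
    have : (g x : ℂ) ≠ 0 := by exact_mod_cast (hgpos x (hposI x hx)).ne'
    simp only [hu]
    field_simp
  have huM : u M = 0 := by simp [hu, hMψ M le_rfl]
  rw [hlhs, huM, zero_mul, zero_sub] at hparts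
  have hexp : ∀ x, a ≤ x → Real.exp (1 / x ^ p) ≤ Real.exp (1 / a ^ p) := by
    intro x hx
    apply Real.exp_le_exp.mpr
    have : 0 < a ^ p := Real.rpow_pos_of_pos ha p
    have : a ^ p ≤ x ^ p := Real.rpow_le_rpow ha.le hx hp.le
    gcongr
  have hgb : ∀ x, a ≤ x → x ≤ M → g x ≤ M ^ (p + 1) / p * Real.exp (1 / a ^ p) := by
    intro x hax hxM
    have hx0 : 0 < x := ha.trans_le hax
    have h2 : x ^ (p + 1) ≤ M ^ (p + 1) := Real.rpow_le_rpow hx0.le hxM (by linarith)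
    have := hexp x hax
    simp only [hg]
    rw [div_mul_eq_mul_div]
    gcongr
  have hg'b : ∀ x, a ≤ x → x ≤ M → |g' x| ≤ ((p + 1) * M ^ p + p) / p * Real.exp (1 / a ^ p) := by
    intro x hax hxM
    have hx0 : 0 < x := ha.trans_le hax
    have h2 : x ^ p ≤ M ^ p := Real.rpow_le_rpow hx0.le hxM hp.le
    have h3 : 0 < x ^ p := Real.rpow_pos_of_pos hx0 p
    have := hexp x hax
    simp only [hg']
    rw [div_mul_eq_mul_div, abs_div, abs_mul, abs_of_pos hp, abs_of_pos (Real.exp_pos _)]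
    have h4 : |(p + 1) * x ^ p - p| ≤ (p + 1) * M ^ p + p := by
      have : (p + 1) * x ^ p ≤ (p + 1) * M ^ p := by gcongr
      have : 0 < (p + 1) * x ^ p := by positivity
      rw [abs_le]; constructor <;> linarith
    gcongr
  have hua : ‖u a * w a‖ ≤ K * (M ^ (p + 1) / p * Real.exp (1 / a ^ p)) := by
    rw [norm_mul, hwn, mul_one]
    simp only [hu]
    rw [norm_mul, Complex.norm_real, Real.norm_of_nonneg (hgpos a ha).le]
    exact mul_le_mul (h0 a) (hgb a le_rfl haM) (hgpos a ha).le hK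
  have hint : ‖∫ x in a..M, u' x * w x‖ ≤ K * (D * Real.exp (1 / a ^ p)) * |M - a| := by
    apply intervalIntegral.norm_integral_le_of_norm_le_const
    intro x hx
    rw [Set.uIoc_of_le haM] at hx
    have hx0 : 0 < x := ha.trans hx.1
    rw [norm_mul, hwn, mul_one]
    simp only [hu']
    have b1 : ‖deriv ψ x * (g x : ℝ)‖ ≤ K * (M ^ (p + 1) / p * Real.exp (1 / a ^ p)) := by
      rw [norm_mul, Complex.norm_real, Real.norm_of_nonneg (hgpos x hx0).le]
      exact mul_le_mul (h1 x) (hgb x hx.1.le hx.2) (hgpos x hx0).le hK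
    have b2 : ‖ψ x * (g' x : ℝ)‖ ≤ K * (((p + 1) * M ^ p + p) / p * Real.exp (1 / a ^ p)) := by
      rw [norm_mul, Complex.norm_real]
      exact mul_le_mul (h0 x) (hg'b x hx.1.le hx.2) (norm_nonneg _) hK
    refine (norm_add_le _ _).trans ((add_le_add b1 b2).trans (le_of_eq ?_))
    rw [hD]; ring
  have hMa : |M - a| ≤ M := by rw [abs_of_nonneg (by linarith)]; linarith
  have hfin : t * ‖∫ x in a..M, w x * ψ x‖ ≤
      (M ^ (p + 1) / p + D * M) * K * Real.exp (1 / a ^ p) := by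
    have e : ‖Complex.I * t * ∫ x in a..M, w x * ψ x‖ = t * ‖∫ x in a..M, w x * ψ x‖ := by
      rw [norm_mul, norm_mul, Complex.norm_I, one_mul, Complex.norm_real,
        Real.norm_of_nonneg ht.le]
    rw [← e, hparts]
    have : K * (D * Real.exp (1 / a ^ p)) * |M - a| ≤ K * (D * Real.exp (1 / a ^ p)) * M := by
      gcongr
    calc _ ≤ ‖-(u a * w a)‖ + ‖∫ x in a..M, u' x * w x‖ := norm_sub_le _ _
      _ ≤ _ := by rw [norm_neg]; linarith
  rw [le_div_iff₀ ht]
  linarith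

theorem tendsto_rpow_sq_mul_sq_add_mul_rpow_neg (c r : ℝ) :
    Tendsto (fun s : ℝ => (s ^ 2) ^ r * (s ^ 2 + c * s) ^ (-r)) atTop (nhds 1) := by
  have h1 : Tendsto (fun s : ℝ => 1 + c / s) atTop (nhds (1 + 0)) :=
    tendsto_const_nhds.add (tendsto_const_nhds.div_atTop tendsto_id)
  rw [add_zero] at h1
  have h2 := h1.rpow_const (p := -r) (Or.inl one_ne_zero)
  rw [Real.one_rpow] at h2
  refine h2.congr' ?_
  filter_upwards [eventually_gt_atTop 0, eventually_gt_atTop (-c)] with s hs hsc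
  have : s ^ 2 + c * s = s ^ 2 * (1 + c / s) := by field_simp
  have h3 : 0 ≤ 1 + c / s := by
    have : 1 + c / s = (s + c) / s := by field_simp
    rw [this]; apply div_nonneg <;> linarith
  rw [this, Real.mul_rpow (by positivity) h3, ← mul_assoc, ← Real.rpow_add (by positivity)]
  simp

/-- Asymptotics of the oscillatory integral with phase `exp (-1 / x ^ p)`, uniform over amplitudes
with a common support bound and a common `C¹` bound. -/
theorem exists_norm_log_rpow_mul_integral_flat_phase_sub_le (p : ℝ) (hp : 0 < p) (M : ℝ)
    (hM : 0 < M) :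
    ∃ r : ℝ → ℝ, Tendsto r atTop (nhds 0) ∧ ∀ᶠ t : ℝ in atTop, ∀ K : ℝ, 0 ≤ K → ∀ ψ : ℝ → ℂ,
      ContDiff ℝ 1 ψ → (∀ x, ‖ψ x‖ ≤ K) → (∀ x, ‖deriv ψ x‖ ≤ K) → (∀ x, M ≤ |x| → ψ x = 0) →
      ‖((Real.log t ^ (1 / p) : ℝ) : ℂ) * (∫ x in Set.Ioi (0 : ℝ),
        Complex.exp (Complex.I * t * (Real.exp (-1 / x ^ p) : ℝ)) * ψ x) - ψ 0‖ ≤ K * r t := by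
  obtain ⟨C, hC, htail⟩ := exists_norm_integral_flat_phase_tail_le p hp M hM
  set R : ℝ → ℝ := fun s =>
    |(s ^ 2) ^ (1 / p) * (s ^ 2 + 1 * s) ^ (-(1 / p)) - 1| +
    (s ^ 2) ^ (1 / p) * (s ^ 2 + 1 * s) ^ (-(1 / p)) *
      (Real.exp (-1 * s) + (s ^ 2 + 1 * s) ^ (-(1 / p))) +
    ((s ^ 2) ^ (1 / p) * (s ^ 2 + -1 * s) ^ (-(1 / p)) -
      (s ^ 2) ^ (1 / p) * (s ^ 2 + 1 * s) ^ (-(1 / p))) +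
    C * ((s ^ 2) ^ (1 / p) * Real.exp (-1 * s)) with hR
  have hp' : 0 < 1 / p := by positivity
  have hRlim : Tendsto R atTop (nhds 0) := by
    have l1 := tendsto_rpow_sq_mul_sq_add_mul_rpow_neg 1 (1 / p)
    have l2 := tendsto_rpow_sq_mul_sq_add_mul_rpow_neg (-1) (1 / p)
    have l3 : Tendsto (fun s : ℝ => Real.exp (-1 * s)) atTop (nhds 0) := by
      simpa using Real.tendsto_exp_neg_atTop_nhds_zero
    have l4 : Tendsto (fun s : ℝ => (s ^ 2 + 1 * s) ^ (-(1 / p))) atTop (nhds 0) := by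
      refine (tendsto_rpow_neg_atTop hp').comp ?_
      exact Tendsto.atTop_add_atTop (tendsto_pow_atTop two_ne_zero)
        (tendsto_id.const_mul_atTop one_pos)
    have l5 : Tendsto (fun s : ℝ => (s ^ 2) ^ (1 / p) * Real.exp (-1 * s)) atTop (nhds 0) := by
      refine (tendsto_rpow_mul_exp_neg_mul_atTop_nhds_zero (2 * (1 / p)) 1 one_pos).congr' ?_
      filter_upwards [eventually_gt_atTop 0] with s hs
      rw [Real.rpow_mul hs.le, Real.rpow_two]
    have := (((l1.sub_const 1).abs.add (l1.mul (l3.add l4))).add (l2.sub l1)).add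
      (l5.const_mul C)
    simpa [hR] using this
  refine ⟨fun t => R (Real.sqrt (Real.log t)),
    hRlim.comp (Real.tendsto_sqrt_atTop.comp Real.tendsto_log_atTop), ?_⟩
  filter_upwards [Real.tendsto_log_atTop.eventually_gt_atTop 1, eventually_gt_atTop 0]
    with t hL ht K hK ψ hψ h0 h1 hMψ
  set L := Real.log t with hLdef
  set s := Real.sqrt L with hs
  have hsL : s ^ 2 = L := Real.sq_sqrt (by linarith)
  have hs1 : 1 < s := by
    rw [hs]; exact Real.lt_sqrt_of_sq_lt (by simpa using hL)
  have htL : t = Real.exp L := (Real.exp_log ht).symm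
  set b := (s ^ 2 + 1 * s) ^ (-(1 / p)) with hb
  set a := (s ^ 2 + -1 * s) ^ (-(1 / p)) with ha
  have hpos : 0 < s ^ 2 + -1 * s := by nlinarith
  have hb0 : 0 < b := by positivity
  have ha0 : 0 < a := Real.rpow_pos_of_pos hpos _
  have hba : b ≤ a := by
    rw [hb, ha, Real.rpow_neg (by positivity), Real.rpow_neg hpos.le]
    have := Real.rpow_pos_of_pos hpos (1 / p)
    have h3 : (s ^ 2 + -1 * s) ^ (1 / p) ≤ (s ^ 2 + 1 * s) ^ (1 / p) :=
      Real.rpow_le_rpow hpos.le (by linarith) hp'.le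
    exact inv_anti₀ this h3
  have hpp : -(1 / p) * p = -1 := by field_simp
  have hbp : b ^ p = (s ^ 2 + 1 * s)⁻¹ := by
    rw [hb, ← Real.rpow_mul (by positivity), hpp, Real.rpow_neg_one]
  have hap : a ^ p = (s ^ 2 + -1 * s)⁻¹ := by
    rw [ha, ← Real.rpow_mul hpos.le, hpp, Real.rpow_neg_one]
  set w : ℝ → ℂ := fun x => Complex.exp (Complex.I * t * (Real.exp (-1 / x ^ p) : ℝ)) with hw
  have hwe : ∀ x, w x = Complex.exp (Complex.I * ((t * Real.exp (-1 / x ^ p) : ℝ) : ℂ)) := by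
    intro x; simp only [hw]; push_cast; rw [mul_assoc]
  have hwn : ∀ x, ‖w x‖ = 1 := fun x => by rw [hwe]; exact Complex.norm_exp_I_mul_ofReal _
  have hwm : Measurable w := by
    simp only [hw]; fun_prop
  have hψi : Integrable ψ :=
    hψ.continuous.integrable_of_hasCompactSupport
      (HasCompactSupport.intro (isCompact_Icc (a := -M) (b := M)) fun x hx => hMψ x (by
        by_contra h
        exact hx (abs_le.mp (not_le.mp h).le)))
  have hwψ : Integrable (fun x => w x * ψ x) :=
    hψi.bdd_mul hwm.aestronglyMeasurable (ae_of_all _ fun x => (hwn x).le)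
  have hsp1 : ∫ x in Set.Ioi (0 : ℝ), w x * ψ x
      = (∫ x in (0 : ℝ)..b, w x * ψ x) + (∫ x in b..a, w x * ψ x)
        + ∫ x in Set.Ioi a, w x * ψ x := by
    rw [intervalIntegral.integral_add_adjacent_intervals hwψ.intervalIntegrable
      hwψ.intervalIntegrable, intervalIntegral.integral_interval_add_Ioi
      hwψ.integrableOn hwψ.integrableOn]
  have e1 : ‖(∫ x in (0 : ℝ)..b, w x * ψ x) - b * ψ 0‖ ≤ K * (Real.exp (-1 * s) + b) * b := by
    have : (∫ x in (0 : ℝ)..b, w x * ψ x) - b * ψ 0 = ∫ x in (0 : ℝ)..b, (w x * ψ x - ψ 0) := by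
      rw [intervalIntegral.integral_sub hwψ.intervalIntegrable intervalIntegrable_const]
      simp
    rw [this]
    have hbb : |b - 0| = b := by rw [sub_zero, abs_of_pos hb0]
    conv_rhs => rw [← hbb]
    apply intervalIntegral.norm_integral_le_of_norm_le_const
    intro x hx
    rw [Set.uIoc_of_le hb0.le] at hx
    rw [hbb]
    have c1 : ‖w x - 1‖ ≤ Real.exp (-1 * s) := by
      rw [hwe]
      refine Real.norm_exp_I_mul_ofReal_sub_one_le.trans ?_
      rw [Real.norm_of_nonneg (by positivity), htL, ← Real.exp_add]
      apply Real.exp_le_exp.mpr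
      have hxp : x ^ p ≤ (s ^ 2 + 1 * s)⁻¹ := hbp ▸ Real.rpow_le_rpow hx.1.le hx.2 hp.le
      have hxp0 : 0 < x ^ p := Real.rpow_pos_of_pos hx.1 p
      have := inv_anti₀ hxp0 hxp
      rw [inv_inv] at this
      rw [neg_div, one_div]
      linarith
    have c2 : ‖ψ x - ψ 0‖ ≤ K * b := by
      have := Convex.norm_image_sub_le_of_norm_deriv_le (f := ψ) (s := Set.univ) (x := 0) (y := x)
        (fun y _ => hψ.differentiable (by norm_num) y) (fun y _ => h1 y) convex_univ
        (Set.mem_univ _) (Set.mem_univ _)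
      refine this.trans ?_
      rw [sub_zero, Real.norm_of_nonneg hx.1.le]
      exact mul_le_mul_of_nonneg_left hx.2 hK
    have : w x * ψ x - ψ 0 = (w x - 1) * ψ x + (ψ x - ψ 0) := by ring
    rw [this]
    refine (norm_add_le _ _).trans ?_
    rw [norm_mul]
    have := mul_le_mul c1 (h0 x) (norm_nonneg _) (Real.exp_pos _).le
    linarith
  have e2 : ‖∫ x in b..a, w x * ψ x‖ ≤ K * (a - b) := by
    rw [← abs_of_nonneg (sub_nonneg.mpr hba)]
    apply intervalIntegral.norm_integral_le_of_norm_le_const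
    intro x _
    rw [norm_mul, hwn, one_mul]
    exact h0 x
  have e3 : ‖∫ x in Set.Ioi a, w x * ψ x‖ ≤ C * K * Real.exp (-1 * s) := by
    refine (htail t ht a ha0 K hK ψ hψ h0 h1 fun x hx => hMψ x (hx.trans (le_abs_self x))).trans ?_
    rw [hap, one_div, inv_inv, mul_div_assoc, htL, ← Real.exp_sub, hsL]
    apply le_of_eq
    congr 2
    ring
  set ℓ : ℝ := L ^ (1 / p) with hℓ
  have hℓ0 : 0 ≤ ℓ := Real.rpow_nonneg (by linarith) _
  have hRs : R s = |ℓ * b - 1| + ℓ * b * (Real.exp (-1 * s) + b) + (ℓ * a - ℓ * b)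
      + C * (ℓ * Real.exp (-1 * s)) := by
    simp only [hR, hℓ, hsL, hb, ha]
  rw [hRs, hsp1]
  set A := ∫ x in (0 : ℝ)..b, w x * ψ x
  set B := ∫ x in b..a, w x * ψ x
  set T := ∫ x in Set.Ioi a, w x * ψ x
  have hdec : (ℓ : ℂ) * (A + B + T) - ψ 0
      = (ℓ : ℂ) * (A - b * ψ 0) + ℓ * B + ℓ * T + ((ℓ * b - 1 : ℝ) : ℂ) * ψ 0 := by
    push_cast; ring
  rw [hdec]
  have hn : ∀ z : ℂ, ‖(ℓ : ℂ) * z‖ = ℓ * ‖z‖ := fun z => by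
    rw [norm_mul, Complex.norm_real, Real.norm_of_nonneg hℓ0]
  have f4 : ‖((ℓ * b - 1 : ℝ) : ℂ) * ψ 0‖ ≤ |ℓ * b - 1| * K := by
    rw [norm_mul, Complex.norm_real, Real.norm_eq_abs]
    exact mul_le_mul_of_nonneg_left (h0 0) (abs_nonneg _)
  calc _ ≤ ℓ * ‖A - b * ψ 0‖ + ℓ * ‖B‖ + ℓ * ‖T‖ + |ℓ * b - 1| * K := by
        refine (norm_add_le _ _).trans (add_le_add ?_ f4)
        refine (norm_add₃_le).trans_eq ?_
        rw [hn, hn, hn]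
    _ ≤ ℓ * (K * (Real.exp (-1 * s) + b) * b) + ℓ * (K * (a - b)) +
        ℓ * (C * K * Real.exp (-1 * s)) + |ℓ * b - 1| * K := by gcongr
    _ = _ := by ring

theorem norm_cexp_I_mul_mul_pow (ε : ℝ) (q : ℕ) (x : ℝ) :
    ‖Complex.exp (Complex.I * ε * (x : ℂ) ^ q)‖ = 1 := by
  have : Complex.I * ε * (x : ℂ) ^ q = Complex.I * ((ε * x ^ q : ℝ) : ℂ) := by push_cast; ring
  rw [this]; exact Complex.norm_exp_I_mul_ofReal _

/-- The truncated generalized Fresnel integral `∫₀^y exp (i ε s ^ q) ds` converges as `y → ∞`. -/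
theorem exists_tendsto_fresnel_s1 (q : ℕ) (hq : 2 ≤ q) (ε : ℝ) (hε : ε ≠ 0) :
    ∃ c : ℂ, Tendsto (fun y : ℝ => ∫ s in (0 : ℝ)..y, Complex.exp (Complex.I * ε * (s : ℂ) ^ q))
      atTop (nhds c) := by
  obtain ⟨n, rfl⟩ := Nat.exists_eq_add_of_le hq
  set w : ℝ → ℂ := fun s => Complex.exp (Complex.I * ε * (s : ℂ) ^ (2 + n)) with hw
  have hwc : Continuous w := by fun_prop
  have hwn : ∀ x, ‖w x‖ = 1 := norm_cexp_I_mul_mul_pow ε (2 + n)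
  set k : ℂ := Complex.I * ε * ((2 + n : ℕ) : ℂ) with hk
  have hk0 : k ≠ 0 := by
    refine mul_ne_zero (mul_ne_zero Complex.I_ne_zero (by exact_mod_cast hε)) ?_
    exact_mod_cast (by omega : 2 + n ≠ 0)
  set v : ℝ → ℂ := fun s => (((s : ℂ) ^ (n + 1))⁻¹) / k with hv
  set v' : ℝ → ℂ := fun s => (-((n + 1 : ℕ) : ℂ) * (s : ℂ) ^ n / ((s : ℂ) ^ (n + 1)) ^ 2) / k
    with hv'
  have hvd : ∀ x : ℝ, 0 < x → HasDerivAt v (v' x) x := by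
    intro x hx
    have hx' : (x : ℂ) ≠ 0 := by exact_mod_cast hx.ne'
    have h1 : HasDerivAt (fun s : ℝ => (s : ℂ) ^ (n + 1)) (((n + 1 : ℕ) : ℂ) * (x : ℂ) ^ n) x := by
      have := (hasDerivAt_pow (n + 1) (x : ℂ)).comp_ofReal
      simpa using this
    refine ((h1.fun_inv (pow_ne_zero _ hx')).div_const k).congr_deriv ?_
    simp only [hv']; rw [neg_mul]
  have hwd : ∀ x : ℝ, HasDerivAt w (w x * (k * (x : ℂ) ^ (n + 1))) x := by
    intro x
    have h1 : HasDerivAt (fun s : ℝ => (s : ℂ) ^ (2 + n))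
        (((2 + n : ℕ) : ℂ) * (x : ℂ) ^ (n + 1)) x := by
      have := (hasDerivAt_pow (2 + n) (x : ℂ)).comp_ofReal
      rwa [show 2 + n - 1 = n + 1 by omega] at this
    refine ((h1.const_mul (Complex.I * ε)).cexp).congr_deriv ?_
    simp only [hw, hk]; ring
  have hv'c : ContinuousOn v' (Set.Ioi 0) := by
    have h1 : ContinuousOn (fun s : ℝ => (s : ℂ)) (Set.Ioi 0) :=
      Complex.continuous_ofReal.continuousOn
    refine (((continuousOn_const.mul (h1.pow n)).div ((h1.pow (n + 1)).pow 2) ?_)).div_const k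
    intro x hx
    have hx' : (x : ℂ) ≠ 0 := by exact_mod_cast (ne_of_gt hx)
    exact pow_ne_zero _ (pow_ne_zero _ hx')
  have hint : IntegrableOn (fun s => v' s * w s) (Set.Ioi 1) := by
    have hdom : IntegrableOn (fun s : ℝ => ((n + 1 : ℕ) : ℝ) / ‖k‖ * s ^ (-2 : ℝ)) (Set.Ioi 1) :=
      (integrableOn_Ioi_rpow_of_lt (by norm_num) one_pos).const_mul _
    refine Integrable.mono' hdom
      (((hv'c.mono (Set.Ioi_subset_Ioi zero_le_one)).mul hwc.continuousOn).aestronglyMeasurable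
        measurableSet_Ioi) ?_
    filter_upwards [ae_restrict_mem measurableSet_Ioi] with x hx
    have hx1 : (1 : ℝ) < x := hx
    have hx0 : 0 < x := by linarith
    rw [norm_mul, hwn, mul_one]
    simp only [hv']
    rw [norm_div, norm_div, norm_mul, norm_neg, norm_pow, norm_pow, norm_pow, Complex.norm_natCast,
      Complex.norm_real, Real.norm_of_nonneg hx0.le, Real.rpow_neg hx0.le, Real.rpow_two]
    have h2 : x ^ n / (x ^ (n + 1)) ^ 2 ≤ (x ^ 2)⁻¹ := by
      rw [div_le_iff₀ (by positivity), inv_mul_eq_div, le_div_iff₀ (by positivity)]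
      calc x ^ n * x ^ 2 = x ^ (n + 2) := by ring
        _ ≤ x ^ (2 * (n + 1)) := pow_le_pow_right₀ hx1.le (by omega)
        _ = _ := by ring
    calc _ = ((n + 1 : ℕ) : ℝ) / ‖k‖ * (x ^ n / (x ^ (n + 1)) ^ 2) := by ring
      _ ≤ _ := by gcongr
  have hlim := intervalIntegral_tendsto_integral_Ioi 1 hint tendsto_id
  have hbd : Tendsto (fun y : ℝ => v y * w y) atTop (nhds 0) := by
    have h1 : Tendsto (fun y : ℝ => (y ^ (n + 1))⁻¹ / ‖k‖) atTop (nhds (0 / ‖k‖)) :=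
      ((tendsto_pow_atTop (by omega)).inv_tendsto_atTop).div_const _
    rw [zero_div] at h1
    refine squeeze_zero_norm' ?_ h1
    filter_upwards [eventually_gt_atTop 0] with y hy
    rw [norm_mul, hwn, mul_one]
    simp only [hv]
    rw [norm_div, norm_inv, norm_pow, Complex.norm_real, Real.norm_of_nonneg hy.le]
  refine ⟨(∫ s in (0 : ℝ)..1, w s) + (0 - v 1 * w 1 - ∫ s in Set.Ioi 1, v' s * w s), ?_⟩
  refine (tendsto_const_nhds.add ((hbd.sub_const _).sub hlim)).congr' ?_
  filter_upwards [eventually_ge_atTop 1] with y hy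
  have hpos : ∀ x ∈ Set.uIcc 1 y, 0 < x := fun x hx => by
    rw [Set.uIcc_of_le hy] at hx; linarith [hx.1]
  have hparts := intervalIntegral.integral_mul_deriv_eq_deriv_mul (a := 1) (b := y)
    (fun x hx => hvd x (hpos x hx)) (fun x _ => hwd x)
    (hv'c.mono fun x hx => hpos x hx).intervalIntegrable
    (Continuous.intervalIntegrable (by fun_prop) _ _)
  have hl : ∫ x in (1 : ℝ)..y, v x * (w x * (k * (x : ℂ) ^ (n + 1))) = ∫ x in (1 : ℝ)..y, w x := by
    apply intervalIntegral.integral_congr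
    intro x hx
    have hx' : (x : ℂ) ≠ 0 := by exact_mod_cast (hpos x hx).ne'
    simp only [hv]
    field_simp
  rw [hl] at hparts
  rw [id, ← hparts]
  exact intervalIntegral.integral_add_adjacent_intervals (hwc.intervalIntegrable _ _)
    (hwc.intervalIntegrable _ _)

/-- `∫₀^∞ exp (-(1 + i τ) x ^ q) dx = Γ(1/q + 1) (1 + i τ) ^ (-1/q)`, in product form. -/
theorem integral_cexp_neg_one_add_mul_I_mul_pow_mul_cpow (q : ℕ) (hq : 1 ≤ q) (τ : ℝ) :
    (∫ x in Set.Ioi (0 : ℝ), Complex.exp (-(1 + τ * Complex.I) * (x : ℂ) ^ q)) *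
      (1 + τ * Complex.I) ^ (1 / (q : ℂ)) = (Real.Gamma (1 / (q : ℝ) + 1) : ℝ) := by
  have hq0 : (0 : ℝ) < q := by exact_mod_cast hq
  have hqc : (q : ℂ) ≠ 0 := by exact_mod_cast hq0.ne'
  set f : ℝ → ℝ → ℂ := fun τ x => Complex.exp (-(1 + τ * Complex.I) * (x : ℂ) ^ q) with hf
  have hfn : ∀ τ x, ‖f τ x‖ = Real.exp (-x ^ q) := by
    intro τ x
    simp only [hf]
    rw [Complex.norm_exp]
    congr 1
    have : (-(1 + τ * Complex.I) * (x : ℂ) ^ q) = ((-x ^ q : ℝ) : ℂ) + ((-τ * x ^ q : ℝ) : ℂ) *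
      Complex.I := by push_cast; ring
    rw [this]; simp [-Complex.ofReal_pow, -Complex.ofReal_neg, -Complex.ofReal_mul]
  have hfc : ∀ τ, Continuous (f τ) := fun τ => by fun_prop
  have hint0 : IntegrableOn (fun x : ℝ => Real.exp (-x ^ q)) (Set.Ioi 0) := by
    have := integrableOn_rpow_mul_exp_neg_rpow (p := q) (s := 0) (by norm_num) hq0
    simpa using this
  have hint1 : IntegrableOn (fun x : ℝ => x ^ q * Real.exp (-x ^ q)) (Set.Ioi 0) := by
    have := integrableOn_rpow_mul_exp_neg_rpow (p := q) (s := q) (by linarith) hq0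
    simpa using this
  have hfi : ∀ τ, IntegrableOn (f τ) (Set.Ioi 0) := fun τ =>
    Integrable.mono' hint0 (hfc τ).aestronglyMeasurable (ae_of_all _ fun x => (hfn τ x).le)
  have hfi1 : ∀ τ, IntegrableOn (fun x : ℝ => (x : ℂ) ^ q * f τ x) (Set.Ioi 0) := fun τ => by
    refine Integrable.mono' hint1 (by fun_prop) ?_
    filter_upwards [ae_restrict_mem measurableSet_Ioi] with x hx
    rw [norm_mul, hfn, norm_pow, Complex.norm_real, Real.norm_of_nonneg (le_of_lt hx)]
  have hre : ∀ τ : ℝ, (1 + τ * Complex.I) ∈ Complex.slitPlane := fun τ => by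
    left; simp
  have hne : ∀ τ : ℝ, (1 + τ * Complex.I) ≠ 0 := fun τ => Complex.slitPlane_ne_zero (hre τ)
  have hparts : ∀ τ : ℝ, (q : ℂ) * (1 + τ * Complex.I) * ∫ x in Set.Ioi (0 : ℝ), (x : ℂ) ^ q * f τ x
      = ∫ x in Set.Ioi (0 : ℝ), f τ x := by
    intro τ
    have hd : ∀ x : ℝ, HasDerivAt (fun x : ℝ => (x : ℂ) * f τ x)
        (f τ x - (q : ℂ) * (1 + τ * Complex.I) * ((x : ℂ) ^ q * f τ x)) x := by
      intro x
      have h1 : HasDerivAt (fun s : ℝ => (s : ℂ) ^ q) ((q : ℂ) * (x : ℂ) ^ (q - 1)) x :=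
        (hasDerivAt_pow q (x : ℂ)).comp_ofReal
      have h2 := (h1.const_mul (-(1 + τ * Complex.I))).cexp
      have h3 : HasDerivAt (fun s : ℝ => (s : ℂ)) 1 x := (hasDerivAt_id (x : ℂ)).comp_ofReal
      refine (h3.fun_mul h2).congr_deriv ?_
      simp only [hf]
      have : (x : ℂ) ^ q = x ^ (q - 1) * x := by rw [← pow_succ]; congr 1; omega
      rw [this]; ring
    have hlim : Tendsto (fun x : ℝ => (x : ℂ) * f τ x) atTop (nhds 0) := by
      have h1 := tendsto_rpow_mul_exp_neg_mul_atTop_nhds_zero 1 1 one_pos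
      refine squeeze_zero_norm' ?_ h1
      filter_upwards [eventually_ge_atTop 1] with x hx
      rw [norm_mul, hfn, Complex.norm_real, Real.norm_of_nonneg (by linarith), Real.rpow_one]
      have : x ≤ x ^ q := le_self_pow₀ hx (by omega)
      gcongr
      linarith
    have := integral_Ioi_of_hasDerivAt_of_tendsto (a := 0)
      (hd 0).continuousAt.continuousWithinAt (fun x _ => hd x)
      ((hfi τ).sub ((hfi1 τ).const_mul _)) hlim
    rw [integral_sub (hfi τ) ((hfi1 τ).const_mul _), integral_const_mul] at this
    simp only [Complex.ofReal_zero, zero_mul, sub_zero] at this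
    exact (sub_eq_zero.mp this).symm
  set G : ℝ → ℂ := fun τ => ∫ x in Set.Ioi (0 : ℝ), f τ x with hG
  have hGd : ∀ τ, HasDerivAt G (-Complex.I * ∫ x in Set.Ioi (0 : ℝ), (x : ℂ) ^ q * f τ x) τ := by
    intro τ
    have := (hasDerivAt_integral_of_dominated_loc_of_deriv_le (𝕜 := ℝ) (μ := volume.restrict
      (Set.Ioi (0 : ℝ))) (F := f) (F' := fun τ x => -Complex.I * ((x : ℂ) ^ q * f τ x)) (x₀ := τ)
      (bound := fun x => x ^ q * Real.exp (-x ^ q)) (s := Set.univ) univ_mem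
      (Eventually.of_forall fun σ => (hfc σ).aestronglyMeasurable) (hfi τ)
      ((hfi1 τ).const_mul _).aestronglyMeasurable ?_ hint1 ?_).2
    · rwa [integral_const_mul] at this
    · filter_upwards [ae_restrict_mem measurableSet_Ioi] with x hx σ _
      rw [norm_mul, norm_neg, Complex.norm_I, one_mul, norm_mul, hfn, norm_pow, Complex.norm_real,
        Real.norm_of_nonneg (le_of_lt hx)]
    · refine ae_of_all _ fun x σ _ => ?_
      have h1 : HasDerivAt (fun s : ℝ => (s : ℂ)) 1 σ := (hasDerivAt_id (σ : ℂ)).comp_ofReal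
      refine ((((h1.mul_const Complex.I).const_add 1).fun_neg.mul_const
        ((x : ℂ) ^ q)).cexp).congr_deriv ?_
      simp only [hf]; ring
  set P : ℝ → ℂ := fun τ => (1 + τ * Complex.I) ^ (1 / (q : ℂ)) with hP
  have hPd : ∀ τ : ℝ, HasDerivAt P
      (1 / (q : ℂ) * (1 + τ * Complex.I) ^ (1 / (q : ℂ) - 1) * Complex.I) τ := by
    intro τ
    have h1 : HasDerivAt (fun s : ℝ => (s : ℂ)) 1 τ := (hasDerivAt_id (τ : ℂ)).comp_ofReal
    have h2 : HasDerivAt (fun s : ℝ => 1 + (s : ℂ) * Complex.I) Complex.I τ := by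
      simpa using (h1.mul_const Complex.I).const_add 1
    have h3 := ((hasDerivAt_id ((1 : ℂ) + τ * Complex.I)).cpow_const (c := 1 / (q : ℂ)) (hre τ))
    have := h3.scomp (h := fun s : ℝ => 1 + (s : ℂ) * Complex.I) τ h2
    refine this.congr_deriv ?_
    simp only [id, smul_eq_mul]; ring
  have hconst : G τ * P τ = G 0 * P 0 := by
    refine is_const_of_deriv_eq_zero (f := fun τ => G τ * P τ)
      (fun τ => ((hGd τ).mul (hPd τ)).differentiableAt) (fun τ => ?_) τ 0
    rw [((hGd τ).fun_mul (hPd τ)).deriv, Complex.cpow_sub _ _ (hne τ), Complex.cpow_one]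
    simp only [hG, hP]
    rw [← hparts τ]
    have := hne τ
    generalize (1 : ℂ) + τ * Complex.I = z at this ⊢
    field_simp
    ring
  change G τ * P τ = _
  rw [hconst]
  have hP0 : P 0 = 1 := by simp [hP]
  rw [hP0, mul_one]
  simp only [hG, hf]
  have h1 := integral_exp_neg_rpow hq0
  rw [← h1, ← integral_complex_ofReal]
  congr 1
  funext x
  push_cast
  simp [Real.rpow_natCast]

theorem tendsto_rpow_mul_integral_cexp_mul_pow (q : ℕ) (hq : 2 ≤ q) (ε : ℝ) (c : ℂ)
    (hc : Tendsto (fun y : ℝ => ∫ s in (0 : ℝ)..y, Complex.exp (Complex.I * ε * (s : ℂ) ^ q))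
      atTop (nhds c))
    (F F' : ℝ → ℝ → ℂ) (G : ℝ → ℂ) (bound : ℝ → ℝ)
    (hF : ∀ᶠ t in atTop, ∀ x, HasDerivAt (F t) (F' t x) x)
    (hFi : ∀ᶠ t in atTop, IntegrableOn (F t) (Set.Ioi 0))
    (hF0 : ∀ᶠ t in atTop, Tendsto (F t) atTop (nhds 0))
    (hF'b : ∀ᶠ t in atTop, ∀ x, 0 < x → ‖F' t x‖ ≤ bound x)
    (hbound : IntegrableOn bound (Set.Ioi 0))
    (hG : ∀ x, 0 < x → Tendsto (fun t => F' t x) atTop (nhds (G x))) :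
    Tendsto (fun t : ℝ => ((t ^ (1 / (q : ℝ)) : ℝ) : ℂ) * ∫ x in Set.Ioi (0 : ℝ),
        Complex.exp (Complex.I * t * (ε * x ^ q : ℝ)) * F t x)
      atTop (nhds (-(c * ∫ x in Set.Ioi (0 : ℝ), G x))) := by
  set w : ℝ → ℂ := fun s => Complex.exp (Complex.I * ε * (s : ℂ) ^ q) with hw
  set E : ℝ → ℂ := fun y => ∫ s in (0 : ℝ)..y, w s with hE
  have hwc : Continuous w := by fun_prop
  have hEd : ∀ y, HasDerivAt E (w y) y := fun y =>
    intervalIntegral.integral_hasDerivAt_right (hwc.intervalIntegrable _ _)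
      hwc.aestronglyMeasurable.stronglyMeasurableAtFilter hwc.continuousAt
  have hEc : Continuous E := continuous_iff_continuousAt.mpr fun y => (hEd y).continuousAt
  obtain ⟨B, hB⟩ : ∃ B, ∀ y, 0 ≤ y → ‖E y‖ ≤ B := by
    have h1 : ∀ᶠ y in atTop, ‖E y‖ < ‖c‖ + 1 :=
      hc.norm.eventually (gt_mem_nhds (lt_add_one _))
    obtain ⟨N, hN⟩ := eventually_atTop.mp h1
    obtain ⟨B, hB⟩ := (isCompact_Icc (a := 0) (b := N)).exists_bound_of_continuousOn
      hEc.continuousOn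
    refine ⟨max B (‖c‖ + 1), fun y hy => ?_⟩
    rcases le_total y N with h | h
    · exact (hB y ⟨hy, h⟩).trans (le_max_left _ _)
    · exact (hN y h).le.trans (le_max_right _ _)
  have hq0 : (q : ℝ) ≠ 0 := by exact_mod_cast (by omega : q ≠ 0)
  have hscale : Tendsto (fun t : ℝ => t ^ (1 / (q : ℝ))) atTop atTop :=
    tendsto_rpow_atTop (by positivity)
  have hmeas : ∀ᶠ t in atTop, AEStronglyMeasurable (F' t) (volume.restrict (Set.Ioi 0)) := by
    filter_upwards [hF] with t ht
    have : F' t = deriv (F t) := funext fun x => (ht x).deriv.symm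
    rw [this]
    exact (stronglyMeasurable_deriv _).aestronglyMeasurable
  have hmain : Tendsto (fun t : ℝ => ∫ x in Set.Ioi (0 : ℝ), E (t ^ (1 / (q : ℝ)) * x) * F' t x)
      atTop (nhds (∫ x in Set.Ioi (0 : ℝ), c * G x)) := by
    refine tendsto_integral_filter_of_dominated_convergence (fun x => B * bound x) ?_ ?_
      (hbound.const_mul B) ?_
    · filter_upwards [hmeas] with t ht
      exact (hEc.comp (continuous_const.mul continuous_id)).aestronglyMeasurable.mul ht
    · filter_upwards [hF'b, eventually_ge_atTop 0] with t ht ht0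
      filter_upwards [ae_restrict_mem measurableSet_Ioi] with x hx
      rw [norm_mul]
      have h1 := hB (t ^ (1 / (q : ℝ)) * x) (mul_nonneg (Real.rpow_nonneg ht0 _) (le_of_lt hx))
      exact mul_le_mul h1 (ht x hx) (norm_nonneg _) ((norm_nonneg _).trans h1)
    · filter_upwards [ae_restrict_mem measurableSet_Ioi] with x hx
      exact (hc.comp (hscale.atTop_mul_const hx)).mul (hG x hx)
  rw [integral_const_mul] at hmain
  refine hmain.neg.congr' ?_
  filter_upwards [hF, hFi, hF0, hF'b, hmeas, eventually_gt_atTop 0] with t hF hFi hF0 hF'b hm ht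
  set r := t ^ (1 / (q : ℝ)) with hr
  have hr0 : 0 < r := Real.rpow_pos_of_pos ht _
  have hrq : r ^ q = t := by
    rw [hr, ← Real.rpow_natCast, ← Real.rpow_mul ht.le, one_div_mul_cancel hq0, Real.rpow_one]
  have hwr : ∀ x : ℝ, w (r * x) = Complex.exp (Complex.I * t * (ε * x ^ q : ℝ)) := by
    intro x
    simp only [hw]
    congr 1
    rw [← hrq]; push_cast; ring
  have hwn : ∀ x, ‖w x‖ = 1 := norm_cexp_I_mul_mul_pow ε q
  have hEr : ∀ x, HasDerivAt (fun x => E (r * x)) (r * w (r * x)) x := by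
    intro x
    have h1 : HasDerivAt (fun x : ℝ => r * x) r x := by
      simpa using (hasDerivAt_id x).const_mul r
    exact ((hEd (r * x)).scomp x h1).congr_deriv (Complex.real_smul)
  have hEF : Tendsto (fun x => E (r * x) * F t x) atTop (nhds 0) := by
    have := (hc.comp (tendsto_id.const_mul_atTop hr0)).mul hF0
    simpa using this
  have hF'i : IntegrableOn (F' t) (Set.Ioi 0) :=
    Integrable.mono' hbound hm (by
      filter_upwards [ae_restrict_mem measurableSet_Ioi] with x hx using hF'b x hx)
  have hErc : Continuous fun x => E (r * x) := hEc.comp (continuous_const.mul continuous_id)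
  have i1 : IntegrableOn (fun x => E (r * x) * F' t x) (Set.Ioi 0) :=
    hF'i.bdd_mul (c := B) hErc.aestronglyMeasurable (by
      filter_upwards [ae_restrict_mem measurableSet_Ioi] with x hx
      exact hB _ (mul_nonneg hr0.le (le_of_lt hx)))
  have i2 : IntegrableOn (fun x => (r * w (r * x)) * F t x) (Set.Ioi 0) := by
    refine hFi.bdd_mul (c := r) (by fun_prop) (ae_of_all _ fun x => ?_)
    rw [norm_mul, hwn, mul_one, Complex.norm_real, Real.norm_of_nonneg hr0.le]
  have hcont : Tendsto (fun x => E (r * x) * F t x) (nhdsWithin 0 (Set.Ioi 0)) (nhds 0) := by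
    have h1 : ContinuousAt (fun x => E (r * x) * F t x) 0 :=
      hErc.continuousAt.mul (hF 0).continuousAt
    have h2 : E (r * 0) * F t 0 = 0 := by simp [hE]
    have := h1.tendsto
    rw [h2] at this
    exact this.mono_left nhdsWithin_le_nhds
  have := integral_Ioi_mul_deriv_eq_deriv_mul (a := 0) (fun x _ => hEr x) (fun x _ => hF x)
    i1 i2 hcont hEF
  rw [this, sub_zero, zero_sub, neg_neg, ← integral_const_mul]
  congr 1
  funext x
  rw [hwr, mul_assoc]

/-- The value of the generalized Fresnel integral `∫₀^∞ exp (± i s ^ q) ds`. -/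
theorem tendsto_fresnel (q : ℕ) (hq : 2 ≤ q) (ε : ℝ) (hε : ε = 1 ∨ ε = -1) :
    Tendsto (fun y : ℝ => ∫ s in (0 : ℝ)..y, Complex.exp (Complex.I * ε * (s : ℂ) ^ q)) atTop
      (nhds (((Real.Gamma (1 / (q : ℝ) + 1) : ℝ) : ℂ) *
        Complex.exp (((ε * Real.pi / (2 * (q : ℝ)) : ℝ) : ℂ) * Complex.I))) := by
  have hε0 : ε ≠ 0 := by rcases hε with h | h <;> rw [h] <;> norm_num
  obtain ⟨c, hc⟩ := exists_tendsto_fresnel_s1 q hq ε hε0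
  convert hc using 2
  have hq0 : (0 : ℝ) < q := by exact_mod_cast (by omega : 0 < q)
  have hqc : (q : ℂ) ≠ 0 := by exact_mod_cast hq0.ne'
  set f : ℝ → ℂ := fun x => ((Real.exp (-x ^ q) : ℝ) : ℂ) with hf
  set f' : ℝ → ℂ := fun x => ((-((q : ℝ) * x ^ (q - 1)) * Real.exp (-x ^ q) : ℝ) : ℂ) with hf'
  have hfd : ∀ x, HasDerivAt f (f' x) x := by
    intro x
    refine HasDerivAt.ofReal_comp ?_
    refine ((hasDerivAt_pow q x).fun_neg.exp).congr_deriv (by ring)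
  have hfi : IntegrableOn f (Set.Ioi 0) := by
    have := integrableOn_rpow_mul_exp_neg_rpow (p := q) (s := 0) (by norm_num) hq0
    have h1 : IntegrableOn (fun x : ℝ => Real.exp (-x ^ q)) (Set.Ioi 0) := by simpa using this
    exact Integrable.ofReal (𝕜 := ℂ) h1
  have hb : IntegrableOn (fun x : ℝ => q * (x ^ (q - 1) * Real.exp (-x ^ q))) (Set.Ioi 0) := by
    have := integrableOn_rpow_mul_exp_neg_rpow (p := q) (s := ((q - 1 : ℕ) : ℝ))
      (lt_of_lt_of_le (by norm_num) (Nat.cast_nonneg _)) hq0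
    simp only [Real.rpow_natCast] at this
    exact Integrable.const_mul this _
  have hf'b : ∀ x, 0 < x → ‖f' x‖ ≤ q * (x ^ (q - 1) * Real.exp (-x ^ q)) := by
    intro x hx
    simp only [hf']
    rw [Complex.norm_real, norm_mul, norm_neg, Real.norm_of_nonneg (by positivity),
      Real.norm_of_nonneg (by positivity), mul_assoc]
  have hf0 : Tendsto f atTop (nhds 0) := by
    have h1 : Tendsto (fun x : ℝ => Real.exp (-x ^ q)) atTop (nhds 0) :=
      Real.tendsto_exp_neg_atTop_nhds_zero.comp (tendsto_pow_atTop (by omega))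
    exact_mod_cast (Complex.continuous_ofReal.tendsto 0).comp h1
  have hf'i : IntegrableOn f' (Set.Ioi 0) := by
    refine Integrable.mono' hb (by fun_prop) ?_
    filter_upwards [ae_restrict_mem measurableSet_Ioi] with x hx using hf'b x hx
  have hlim := tendsto_rpow_mul_integral_cexp_mul_pow q hq ε c hc (fun _ => f) (fun _ => f') f' _
    (Eventually.of_forall fun _ => hfd) (Eventually.of_forall fun _ => hfi)
    (Eventually.of_forall fun _ => hf0) (Eventually.of_forall fun _ => hf'b) hb
    (fun x _ => tendsto_const_nhds)
  rw [integral_Ioi_of_hasDerivAt_of_tendsto (hfd 0).continuousAt.continuousWithinAt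
    (fun x _ => hfd x) hf'i hf0] at hlim
  have hfz : f 0 = 1 := by
    simp only [hf]
    rw [zero_pow (by omega : q ≠ 0), neg_zero, Real.exp_zero, Complex.ofReal_one]
  rw [hfz] at hlim
  have hcval : -(c * (0 - 1)) = c := by ring
  rw [hcval] at hlim
  refine tendsto_nhds_unique ?_ hlim
  set Γq : ℂ := ((Real.Gamma (1 / (q : ℝ) + 1) : ℝ) : ℂ)
  have hslit : (-(ε : ℂ) * Complex.I) ∈ Complex.slitPlane := by
    right; simpa using hε0
  have hz : Tendsto (fun t : ℝ => (((t⁻¹ : ℝ) : ℂ) + -(ε : ℂ) * Complex.I) ^ (1 / (q : ℂ))) atTop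
      (nhds ((-(ε : ℂ) * Complex.I) ^ (1 / (q : ℂ)))) := by
    have h1 : Tendsto (fun t : ℝ => ((t⁻¹ : ℝ) : ℂ) + -(ε : ℂ) * Complex.I) atTop
        (nhds (((0 : ℝ) : ℂ) + -(ε : ℂ) * Complex.I)) :=
      ((Complex.continuous_ofReal.tendsto 0).comp tendsto_inv_atTop_zero).add_const _
    rw [Complex.ofReal_zero, zero_add] at h1
    exact h1.cpow tendsto_const_nhds hslit
  have hval : (-(ε : ℂ) * Complex.I) ^ (1 / (q : ℂ)) =
      Complex.exp (-(((ε * Real.pi / (2 * (q : ℝ)) : ℝ) : ℂ) * Complex.I)) := by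
    rw [Complex.cpow_def_of_ne_zero (Complex.slitPlane_ne_zero hslit)]
    congr 1
    rcases hε with h | h
    · rw [h]; push_cast; rw [neg_one_mul, Complex.log_neg_I]; field_simp
    · rw [h]; push_cast; rw [neg_neg, one_mul, Complex.log_I]; field_simp
  have hfin := (tendsto_const_nhds (x := Γq)).div hz
    (by rw [hval]; exact Complex.exp_ne_zero _)
  rw [hval, Complex.exp_neg, div_inv_eq_mul] at hfin
  refine hfin.congr' ?_
  filter_upwards [eventually_gt_atTop 0] with t ht
  have hG := integral_cexp_neg_one_add_mul_I_mul_pow_mul_cpow q (by omega) (-(ε * t))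
  have ht' : (t : ℂ) ≠ 0 := by exact_mod_cast ht.ne'
  have hmul : (1 + ((-(ε * t) : ℝ) : ℂ) * Complex.I) =
      (t : ℂ) * (((t⁻¹ : ℝ) : ℂ) + -(ε : ℂ) * Complex.I) := by
    push_cast; field_simp
  have hy : (((t⁻¹ : ℝ) : ℂ) + -(ε : ℂ) * Complex.I) ≠ 0 := by
    intro h
    have := congrArg Complex.re h
    simp at this
    exact ht.ne' this
  have hcp : (1 + ((-(ε * t) : ℝ) : ℂ) * Complex.I) ^ (1 / (q : ℂ)) =
      ((t ^ (1 / (q : ℝ)) : ℝ) : ℂ) *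
        (((t⁻¹ : ℝ) : ℂ) + -(ε : ℂ) * Complex.I) ^ (1 / (q : ℂ)) := by
    rw [hmul, Complex.cpow_def_of_ne_zero (mul_ne_zero ht' hy), Complex.log_ofReal_mul ht hy,
      add_mul, Complex.exp_add, ← Complex.cpow_def_of_ne_zero hy, Complex.ofReal_cpow ht.le,
      Complex.cpow_def_of_ne_zero ht', Complex.ofReal_log ht.le]
    push_cast; rfl
  rw [hcp] at hG
  have hyq : (((t⁻¹ : ℝ) : ℂ) + -(ε : ℂ) * Complex.I) ^ (1 / (q : ℂ)) ≠ 0 := by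
    rw [Complex.cpow_def_of_ne_zero hy]; exact Complex.exp_ne_zero _
  have hI : ∫ x in Set.Ioi (0 : ℝ), Complex.exp (Complex.I * t * (ε * x ^ q : ℝ)) * f x =
      ∫ x in Set.Ioi (0 : ℝ), Complex.exp (-(1 + ((-(ε * t) : ℝ) : ℂ) * Complex.I) * (x : ℂ) ^ q) := by
    congr 1
    funext x
    simp only [hf]
    rw [Complex.ofReal_exp, ← Complex.exp_add]
    congr 1
    push_cast; ring
  simp only [Pi.div_apply]
  rw [hI, div_eq_iff hyq]
  change _ = Γq at hG
  rw [← hG]; ring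

theorem stmt1 (p : ℝ) (hp : 0 < p) (q : ℕ) (hq : 2 ≤ q)
    (ε : ℝ) (hε : ε = 1 ∨ ε = -1)
    (φ : ℝ × ℝ → ℝ) (hφ : ContDiff ℝ (⊤ : ℕ∞) φ) (hφc : HasCompactSupport φ) :
    Tendsto (fun t : ℝ =>
        ((t ^ (1 / (q : ℝ)) * (Real.log t) ^ (1 / p) : ℝ) : ℂ) *
          ∫ x₂ in Set.Ioi (0 : ℝ), ∫ x₁ in Set.Ioi (0 : ℝ),
            Complex.exp (Complex.I * (t : ℂ) *
                ((ε * x₂ ^ q + Real.exp (-1 / x₁ ^ p) : ℝ) : ℂ)) *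
              ((φ (x₁, x₂) : ℝ) : ℂ))
      atTop
      (nhds (((Real.Gamma (1 / (q : ℝ) + 1) : ℝ) : ℂ) *
        Complex.exp (((ε * Real.pi / (2 * (q : ℝ)) : ℝ) : ℂ) * Complex.I) *
        ((φ (0, 0) : ℝ) : ℂ))) := by
  set c : ℂ := ((Real.Gamma (1 / (q : ℝ) + 1) : ℝ) : ℂ) *
    Complex.exp (((ε * Real.pi / (2 * (q : ℝ)) : ℝ) : ℂ) * Complex.I)
  have hc := tendsto_fresnel q hq ε hε
  set D : ℝ × ℝ → ℝ := fun z => fderiv ℝ φ z (0, 1) with hD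
  have hDs : ContDiff ℝ (⊤ : ℕ∞) D := (hφ.fderiv_right (by simp)).clm_apply contDiff_const
  obtain ⟨M, hM, hsub⟩ := hφc.isCompact.isBounded.subset_ball_lt 0 0
  have hnot : ∀ z : ℝ × ℝ, M ≤ ‖z‖ → z ∉ tsupport φ := fun z hz h => by
    have := hsub h
    rw [mem_ball_zero_iff] at this
    linarith
  have hφ0 : ∀ z : ℝ × ℝ, M ≤ ‖z‖ → φ z = 0 := fun z hz =>
    image_eq_zero_of_notMem_tsupport (hnot z hz)
  have hD0 : ∀ z : ℝ × ℝ, M ≤ ‖z‖ → D z = 0 := fun z hz => by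
    have : fderiv ℝ φ z = 0 := by
      by_contra h
      exact hnot z hz (support_fderiv_subset ℝ h)
    simp only [hD, this, zero_apply]
  have hDc : HasCompactSupport D :=
    HasCompactSupport.intro (isCompact_closedBall 0 M) fun z hz => hD0 z (by
      rw [mem_closedBall_zero_iff, not_le] at hz
      exact hz.le)
  have hn1 : ∀ x y : ℝ, M ≤ |x| → M ≤ ‖((x, y) : ℝ × ℝ)‖ := fun x y h =>
    h.trans (le_max_left _ _)
  have hn2 : ∀ x y : ℝ, M ≤ |y| → M ≤ ‖((x, y) : ℝ × ℝ)‖ := fun x y h =>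
    h.trans (le_max_right _ _)
  have hslice : ∀ χ : ℝ × ℝ → ℝ, Continuous χ → (∀ z : ℝ × ℝ, M ≤ ‖z‖ → χ z = 0) → ∀ y,
      Integrable (fun x => ((χ (x, y) : ℝ) : ℂ)) := by
    intro χ hχ h0 y
    refine Continuous.integrable_of_hasCompactSupport (by fun_prop)
      (HasCompactSupport.intro (isCompact_Icc (a := -M) (b := M)) fun x hx => ?_)
    rw [h0 _ (hn1 x y (by
      by_contra h
      exact hx (abs_le.mp (not_le.mp h).le))), Complex.ofReal_zero]
  obtain ⟨K₁, hK₁⟩ := hDc.exists_bound_of_continuous hDs.continuous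
  have hDx : Continuous fun z => fderiv ℝ D z (1, 0) :=
    (hDs.continuous_fderiv (by simp)).clm_apply continuous_const
  obtain ⟨K₂, hK₂⟩ := (hDc.fderiv_apply ℝ ((1, 0) : ℝ × ℝ)).exists_bound_of_continuous hDx
  set K := max K₁ K₂
  have hK : 0 ≤ K := (norm_nonneg _).trans ((hK₁ 0).trans (le_max_left _ _))
  have hDK : ∀ x y, ‖((D (x, y) : ℝ) : ℂ)‖ ≤ K := fun x y => by
    rw [Complex.norm_real]; exact (hK₁ _).trans (le_max_left _ _)
  have hDd : ∀ y x, ‖deriv (fun x : ℝ => ((D (x, y) : ℝ) : ℂ)) x‖ ≤ K := fun y x => by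
    have h1 : HasDerivAt (fun x : ℝ => D (x, y)) (fderiv ℝ D (x, y) (1, 0)) x :=
      HasFDerivAt.comp_hasDerivAt (f := fun x : ℝ => (x, y)) x
        (hDs.differentiable (by simp) (x, y)).hasFDerivAt
        ((hasDerivAt_id x).prodMk (hasDerivAt_const x y))
    rw [h1.ofReal_comp.deriv, Complex.norm_real]
    exact (hK₂ _).trans (le_max_right _ _)
  have hφd : ∀ x y, HasDerivAt (fun y : ℝ => φ (x, y)) (D (x, y)) y := fun x y =>
    ((hφ.differentiable (by simp) (x, y)).hasFDerivAt).comp_hasDerivAt y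
      ((hasDerivAt_const y x).prodMk (hasDerivAt_id y))
  obtain ⟨r, hr, hrb⟩ := exists_norm_log_rpow_mul_integral_flat_phase_sub_le p hp M hM
  set w : ℝ → ℝ → ℂ := fun t x => Complex.exp (Complex.I * t * (Real.exp (-1 / x ^ p) : ℝ)) with hw
  have hwm : ∀ t, Measurable (w t) := fun t => by
    simp only [hw]; fun_prop
  have hwn : ∀ t x, ‖w t x‖ = 1 := fun t x => by
    have : Complex.I * t * (Real.exp (-1 / x ^ p) : ℝ)
      = Complex.I * ((t * Real.exp (-1 / x ^ p) : ℝ) : ℂ) := by push_cast; ring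
    simp only [hw]; rw [this]; exact Complex.norm_exp_I_mul_ofReal _
  have hwi : ∀ χ : ℝ × ℝ → ℝ, Continuous χ → (∀ z : ℝ × ℝ, M ≤ ‖z‖ → χ z = 0) → ∀ t y,
      IntegrableOn (fun x => w t x * ((χ (x, y) : ℝ) : ℂ)) (Set.Ioi 0) := fun χ hχ h0 t y =>
    (((hslice χ hχ h0 y).bdd_mul (c := 1) (hwm t).aestronglyMeasurable
      (ae_of_all _ fun x => (hwn t x).le))).integrableOn
  set F : ℝ → ℝ → ℂ := fun t y => ((Real.log t ^ (1 / p) : ℝ) : ℂ) *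
    ∫ x in Set.Ioi (0 : ℝ), w t x * ((φ (x, y) : ℝ) : ℂ) with hF
  set F' : ℝ → ℝ → ℂ := fun t y => ((Real.log t ^ (1 / p) : ℝ) : ℂ) *
    ∫ x in Set.Ioi (0 : ℝ), w t x * ((D (x, y) : ℝ) : ℂ) with hF'
  have hFd : ∀ t y, HasDerivAt (F t) (F' t y) y := by
    intro t y
    refine HasDerivAt.const_mul _ ?_
    refine (hasDerivAt_integral_of_dominated_loc_of_deriv_le (𝕜 := ℝ)
      (F := fun y x => w t x * ((φ (x, y) : ℝ) : ℂ))
      (F' := fun y x => w t x * ((D (x, y) : ℝ) : ℂ)) (s := Set.univ)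
      (bound := (Set.Icc (-M) M).indicator fun _ => K) univ_mem
      (Eventually.of_forall fun y => (hwi φ hφ.continuous hφ0 t y).aestronglyMeasurable)
      (hwi φ hφ.continuous hφ0 t y) (hwi D hDs.continuous hD0 t y).aestronglyMeasurable
      (ae_of_all _ fun x z _ => ?_) ?_ (ae_of_all _ fun x z _ => ?_)).2
    · rw [norm_mul, hwn, one_mul]
      by_cases hx : x ∈ Set.Icc (-M) M
      · rw [Set.indicator_of_mem hx]; exact hDK x z
      · rw [Set.indicator_of_notMem hx, hD0 _ (hn1 x z (by
          by_contra h
          exact hx (abs_le.mp (not_le.mp h).le)))]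
        simp
    · exact ((integrable_indicator_iff measurableSet_Icc).mpr
        (integrableOn_const (by simp))).integrableOn
    · exact (hφd x z).ofReal_comp.const_mul _
  have hFz : ∀ t y, M ≤ |y| → F t y = 0 := fun t y hy => by
    simp [hF, hφ0 _ (hn2 _ y hy)]
  have hF'z : ∀ t y, M ≤ |y| → F' t y = 0 := fun t y hy => by
    simp [hF', hD0 _ (hn2 _ y hy)]
  have hF't : ∀ᶠ t in atTop, ∀ y, ‖F' t y - ((D (0, y) : ℝ) : ℂ)‖ ≤ K * r t := by
    filter_upwards [hrb] with t ht y
    refine ht K hK (fun x => ((D (x, y) : ℝ) : ℂ)) ?_ (fun x => hDK x y) (hDd y)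
      fun x hx => by rw [hD0 _ (hn1 x y hx), Complex.ofReal_zero]
    exact Complex.ofRealCLM.contDiff.comp
      ((hDs.of_le (by simp)).comp (contDiff_id.prodMk contDiff_const))
  have hlim := tendsto_rpow_mul_integral_cexp_mul_pow q hq ε c hc F F'
    (fun y => ((D (0, y) : ℝ) : ℂ)) ((Set.Icc (-M) M).indicator fun _ => 2 * K)
    (Eventually.of_forall hFd) (Eventually.of_forall fun t => ?_)
    (Eventually.of_forall fun t => ?_) ?_
    ((integrable_indicator_iff measurableSet_Icc).mpr
      (integrableOn_const (by simp))).integrableOn (fun y _ => ?_)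
  · have hint : ∫ y in Set.Ioi (0 : ℝ), ((D (0, y) : ℝ) : ℂ) = 0 - ((φ (0, 0) : ℝ) : ℂ) := by
      refine integral_Ioi_of_hasDerivAt_of_tendsto (f := fun y : ℝ => ((φ (0, y) : ℝ) : ℂ))
        (Continuous.continuousWithinAt (by have := hφ.continuous; fun_prop))
        (fun y _ => (hφd 0 y).ofReal_comp) ?_ ?_
      · refine (Continuous.integrable_of_hasCompactSupport
          (by have := hDs.continuous; fun_prop)
          (HasCompactSupport.intro (isCompact_Icc (a := -M) (b := M)) fun y hy => ?_)).integrableOn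
        rw [hD0 _ (hn2 0 y (by
          by_contra h
          exact hy (abs_le.mp (not_le.mp h).le))), Complex.ofReal_zero]
      · refine tendsto_const_nhds.congr' ?_
        filter_upwards [eventually_ge_atTop M] with y hy
        rw [hφ0 _ (hn2 0 y (hy.trans (le_abs_self y))), Complex.ofReal_zero]
    rw [hint, zero_sub, mul_neg, neg_neg] at hlim
    refine hlim.congr fun t => ?_
    rw [Complex.ofReal_mul, mul_assoc]
    congr 1
    rw [← integral_const_mul]
    congr 1
    funext y
    simp only [hF]
    rw [mul_left_comm, ← integral_const_mul]
    congr 2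
    funext x
    rw [← mul_assoc]
    congr 1
    simp only [hw]
    rw [← Complex.exp_add, Complex.ofReal_add, mul_add]
  · refine (Continuous.integrable_of_hasCompactSupport
      (continuous_iff_continuousAt.mpr fun y => (hFd t y).continuousAt)
      (HasCompactSupport.intro (isCompact_Icc (a := -M) (b := M)) fun y hy => ?_)).integrableOn
    exact hFz t y (by
      by_contra h
      exact hy (abs_le.mp (not_le.mp h).le))
  · refine tendsto_const_nhds.congr' ?_
    filter_upwards [eventually_ge_atTop M] with y hy
    rw [hFz t y (hy.trans (le_abs_self y))]
  · filter_upwards [hF't, hr.eventually (ge_mem_nhds one_pos)] with t ht hrt y _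
    by_cases hy : y ∈ Set.Icc (-M) M
    · rw [Set.indicator_of_mem hy]
      have h1 := norm_le_norm_add_norm_sub' (F' t y) ((D (0, y) : ℝ) : ℂ)
      have h2 : K * r t ≤ K * 1 := mul_le_mul_of_nonneg_left hrt hK
      linarith [ht y, hDK 0 y]
    · rw [Set.indicator_of_notMem hy, hF'z t y (by
        by_contra h
        exact hy (abs_le.mp (not_le.mp h).le)), norm_zero]
  · rw [tendsto_iff_norm_sub_tendsto_zero]
    have h1 : Tendsto (fun t => K * r t) atTop (nhds 0) := by simpa using hr.const_mul K
    exact squeeze_zero' (Eventually.of_forall fun _ => norm_nonneg _)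
      (hF't.mono fun t ht => ht y) h1
end

section
/- Let p > 0 be a real number, let q ≥ 2 be an integer, and let f(x₁,x₂) = x₂^q + e^{-1/|x₁|^p} (extended by f(0,x₂) = x₂^q). Then for every smooth compactly supported function φ : ℝ² → ℝ there exist constants C > 0 and t₀ > 1 such that |∫_{ℝ²} e^{i t f(x₁,x₂)} φ(x₁,x₂) dx₁ dx₂| ≤ C t^{-1/q} (log t)^{-1/p} for all t ≥ t₀. -/
open MeasureTheory Filter

/-- Integration by parts for an oscillatory integral whose phase `h` has nowhere vanishing
derivative, where `w` is the inverse of that derivative. -/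
theorem norm_integral_exp_mul_le_of_inv_deriv {a b M N A B : ℝ} (hab : a ≤ b)
    {h h' w w' : ℝ → ℝ} {ψ ψ' : ℝ → ℂ}
    (hh : ∀ x ∈ Set.Icc a b, HasDerivAt h (h' x) x)
    (hw : ∀ x ∈ Set.Icc a b, HasDerivAt w (w' x) x)
    (hψ : ∀ x, HasDerivAt ψ (ψ' x) x)
    (hwh : ∀ x ∈ Set.Icc a b, w x * h' x = 1)
    (hw'c : ContinuousOn w' (Set.Icc a b)) (hψ'c : Continuous ψ')
    (hM : ∀ x ∈ Set.Icc a b, |w x| ≤ M) (hN : ∫ x in a..b, |w' x| ≤ N)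
    (hA : ∀ x, ‖ψ x‖ ≤ A) (hB : ∀ x, ‖ψ' x‖ ≤ B) :
    ‖∫ x in a..b, Complex.exp ((h x : ℂ) * Complex.I) * ψ x‖ ≤
      2 * M * A + A * N + M * B * (b - a) := by
  have hA0 : 0 ≤ A := (norm_nonneg _).trans (hA 0)
  have hM0 : 0 ≤ M := (abs_nonneg _).trans (hM a (Set.left_mem_Icc.2 hab))
  have hu : Set.uIcc a b = Set.Icc a b := Set.uIcc_of_le hab
  have hec : ContinuousOn (fun x ↦ Complex.exp ((h x : ℂ) * Complex.I)) (Set.Icc a b) := by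
    have : ContinuousOn h (Set.Icc a b) := fun x hx ↦ (hh x hx).continuousAt.continuousWithinAt
    fun_prop
  have hwc : ContinuousOn w (Set.Icc a b) := fun x hx ↦
    (hw x hx).continuousAt.continuousWithinAt
  have hψc : Continuous ψ := continuous_iff_continuousAt.2 fun x ↦ (hψ x).continuousAt
  set e : ℝ → ℂ := fun x ↦ Complex.exp ((h x : ℂ) * Complex.I) with he
  have hen : ∀ x, ‖e x‖ = 1 := fun x ↦ Complex.norm_exp_ofReal_mul_I _
  set F : ℝ → ℂ := fun x ↦ e x * ((w x : ℂ) * ψ x) with hF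
  set r : ℝ → ℂ := fun x ↦ e x * ((w' x : ℂ) * ψ x + (w x : ℂ) * ψ' x) with hr
  have hFd : ∀ x ∈ Set.uIcc a b, HasDerivAt F (Complex.I * (e x * ψ x) + r x) x := by
    intro x hx
    rw [hu] at hx
    have h1 := (((hh x hx).ofReal_comp).mul_const Complex.I).cexp
    have h2 := h1.mul (((hw x hx).ofReal_comp).mul (hψ x))
    refine h2.congr_deriv ?_
    have h3 : (w x : ℂ) * (h' x : ℂ) = 1 := by exact_mod_cast hwh x hx
    simp only [hr, he, Pi.mul_apply]
    linear_combination (Complex.exp ((h x : ℂ) * Complex.I) * Complex.I * ψ x) * h3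
  have hei : IntervalIntegrable (fun x ↦ e x * ψ x) volume a b :=
    ContinuousOn.intervalIntegrable (by rw [hu]; fun_prop)
  have hri : IntervalIntegrable r volume a b :=
    ContinuousOn.intervalIntegrable (by rw [hu]; fun_prop)
  have hw'i : IntervalIntegrable (fun x ↦ |w' x|) volume a b :=
    ContinuousOn.intervalIntegrable (by rw [hu]; exact hw'c.abs)
  have key := intervalIntegral.integral_eq_sub_of_hasDerivAt hFd ((hei.const_mul _).add hri)
  rw [intervalIntegral.integral_add (hei.const_mul _) hri,
    intervalIntegral.integral_const_mul] at key
  have hFn : ∀ x ∈ Set.Icc a b, ‖F x‖ ≤ M * A := by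
    intro x hx
    simp only [hF, norm_mul, hen, one_mul, Complex.norm_real, Real.norm_eq_abs]
    exact mul_le_mul (hM x hx) (hA x) (norm_nonneg _) hM0
  have hrn : ‖∫ x in a..b, r x‖ ≤ A * N + M * B * (b - a) := by
    calc ‖∫ x in a..b, r x‖ ≤ ∫ x in a..b, (A * |w' x| + M * B) := by
          refine intervalIntegral.norm_integral_le_of_norm_le hab
            (Eventually.of_forall fun x hx ↦ ?_)
            ((hw'i.const_mul _).add intervalIntegrable_const)
          have hx' := Set.Ioc_subset_Icc_self hx
          simp only [hr, norm_mul, hen, one_mul]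
          refine (norm_add_le _ _).trans ?_
          simp only [norm_mul, Complex.norm_real, Real.norm_eq_abs]
          rw [mul_comm A]
          exact add_le_add (mul_le_mul_of_nonneg_left (hA x) (abs_nonneg _))
            (mul_le_mul (hM x hx') (hB x) (norm_nonneg _) hM0)
      _ = A * (∫ x in a..b, |w' x|) + M * B * (b - a) := by
          rw [intervalIntegral.integral_add (hw'i.const_mul _) intervalIntegrable_const,
            intervalIntegral.integral_const_mul, intervalIntegral.integral_const, smul_eq_mul]
          ring
      _ ≤ _ := by gcongr
  calc ‖∫ x in a..b, e x * ψ x‖ = ‖Complex.I * ∫ x in a..b, e x * ψ x‖ := by simp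
    _ = ‖F b - F a - ∫ x in a..b, r x‖ := by rw [← key, add_sub_cancel_right]
    _ ≤ ‖F b‖ + ‖F a‖ + ‖∫ x in a..b, r x‖ :=
        (norm_sub_le _ _).trans (add_le_add_left (norm_sub_le _ _) _)
    _ ≤ _ := by
        linarith [hFn a (Set.left_mem_Icc.2 hab), hFn b (Set.right_mem_Icc.2 hab)]

/-- An oscillatory integral with phase `s y ^ q` away from the origin. -/
theorem norm_integral_exp_pow_mul_le {q : ℕ} (hq : 2 ≤ q) {s δ R A B : ℝ} (hs : s ≠ 0)
    (hδ : 0 < δ) (hδR : δ ≤ R) {ψ ψ' : ℝ → ℂ} (hψ : ∀ x, HasDerivAt ψ (ψ' x) x)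
    (hψ'c : Continuous ψ') (hA : ∀ x, ‖ψ x‖ ≤ A) (hB : ∀ x, ‖ψ' x‖ ≤ B) :
    ‖∫ y in δ..R, Complex.exp (((s * y ^ q : ℝ) : ℂ) * Complex.I) * ψ y‖ ≤
      (3 * A + B * R) / (|s| * δ ^ (q - 1)) := by
  obtain ⟨n, rfl⟩ : ∃ n, q = n + 2 := ⟨q - 2, by omega⟩
  have hA0 : 0 ≤ A := (norm_nonneg _).trans (hA 0)
  have hB0 : 0 ≤ B := (norm_nonneg _).trans (hB 0)
  have hs' : 0 < |s| := abs_pos.2 hs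
  have hn : (0 : ℝ) < n + 2 := by positivity
  set v : ℝ → ℝ := fun y ↦ (y ^ (n + 1))⁻¹ with hv
  set v' : ℝ → ℝ := fun y ↦ -((n + 1) * y ^ n) / (y ^ (n + 1)) ^ 2 with hv'
  have hpos : ∀ y ∈ Set.Icc δ R, 0 < y := fun y hy ↦ hδ.trans_le hy.1
  have hvd : ∀ y ∈ Set.Icc δ R, HasDerivAt v (v' y) y := by
    intro y hy
    have h1 := (hasDerivAt_pow (n + 1) y).inv (pow_pos (hpos y hy) _).ne'
    refine h1.congr_deriv ?_
    simp [hv']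
  have hv'c : ContinuousOn v' (Set.Icc δ R) := by
    refine ContinuousOn.div (by fun_prop) (by fun_prop) fun y hy ↦ ?_
    have := hpos y hy
    positivity
  have hvM : ∀ y ∈ Set.Icc δ R, v y ≤ (δ ^ (n + 1))⁻¹ := by
    intro y hy
    simp only [hv]
    have := hy.1
    gcongr
  have hv0 : ∀ y ∈ Set.Icc δ R, 0 ≤ v y := fun y hy ↦ by
    have := hpos y hy
    simp only [hv]
    positivity
  set c : ℝ := (s * (n + 2))⁻¹ with hc
  have hcs : |c| ≤ |s|⁻¹ := by
    rw [hc, abs_inv, abs_mul, abs_of_pos hn]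
    gcongr
    nlinarith
  have hv'0 : ∀ y ∈ Set.Icc δ R, v' y ≤ 0 := fun y hy ↦ by
    have := hpos y hy
    simp only [hv', neg_div]
    have : 0 ≤ ((n : ℝ) + 1) * y ^ n / (y ^ (n + 1)) ^ 2 := by positivity
    linarith
  have hu : Set.uIcc δ R = Set.Icc δ R := Set.uIcc_of_le hδR
  have hN : ∫ y in δ..R, |c * v' y| ≤ |s|⁻¹ * (δ ^ (n + 1))⁻¹ := by
    have h1 : ∫ y in δ..R, |c * v' y| = ∫ y in δ..R, -|c| * v' y := by
      refine intervalIntegral.integral_congr fun y hy ↦ ?_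
      rw [hu] at hy
      simp only [abs_mul, abs_of_nonpos (hv'0 y hy)]
      ring
    rw [h1, intervalIntegral.integral_const_mul,
      intervalIntegral.integral_eq_sub_of_hasDerivAt (by rwa [hu])
        (ContinuousOn.intervalIntegrable (by rwa [hu]))]
    have h2 : |c| * (v δ - v R) ≤ |s|⁻¹ * (δ ^ (n + 1))⁻¹ := by
      refine mul_le_mul hcs ?_ ?_ (by positivity)
      · linarith [hvM δ ⟨le_rfl, hδR⟩, hv0 R ⟨hδR, le_rfl⟩]
      · have := hvM R ⟨hδR, le_rfl⟩
        simp only [hv] at this ⊢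
        linarith
    linarith
  have key := norm_integral_exp_mul_le_of_inv_deriv (M := |s|⁻¹ * (δ ^ (n + 1))⁻¹) hδR
    (h := fun y ↦ s * y ^ (n + 2)) (h' := fun y ↦ s * ((n + 2) * y ^ (n + 1)))
    (w := fun y ↦ c * v y) (w' := fun y ↦ c * v' y)
    (fun y _ ↦ by
      refine ((hasDerivAt_pow (n + 2) y).const_mul s).congr_deriv ?_
      push_cast
      simp)
    (fun y hy ↦ (hvd y hy).const_mul c) hψ
    (fun y hy ↦ by
      have := (hpos y hy).ne'
      simp only [hc, hv]
      field_simp)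
    (by fun_prop) hψ'c
    (fun y hy ↦ by
      rw [abs_mul, abs_of_nonneg (hv0 y hy)]
      exact mul_le_mul hcs (hvM y hy) (hv0 y hy) (by positivity))
    hN hA hB
  refine key.trans ?_
  have h3 : (3 * A + B * R) / (|s| * δ ^ (n + 2 - 1)) =
      |s|⁻¹ * (δ ^ (n + 1))⁻¹ * (3 * A + B * R) := by
    rw [div_eq_mul_inv, mul_inv, show n + 2 - 1 = n + 1 from rfl]
    ring
  rw [h3]
  have h4 : 0 ≤ |s|⁻¹ * (δ ^ (n + 1))⁻¹ * B * δ := by positivity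
  nlinarith

/-- An oscillatory integral with phase `t exp (-x ^ (-p))` on `[0, R]`. -/
theorem exists_norm_integral_exp_exp_neg_rpow_mul_le {p : ℝ} (hp : 0 < p) {R : ℝ} (hR : 1 ≤ R) :
    ∃ C : ℝ, ∀ t ≥ Real.exp 2, ∀ {D : ℝ} {ψ ψ' : ℝ → ℂ}, (∀ x, HasDerivAt ψ (ψ' x) x) →
      Continuous ψ' → (∀ x, ‖ψ x‖ ≤ D) → (∀ x, ‖ψ' x‖ ≤ D) →
      ‖∫ x in (0 : ℝ)..R,
          Complex.exp (((t * Real.exp (-1 / x ^ p) : ℝ) : ℂ) * Complex.I) * ψ x‖ ≤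
        C * D * Real.log t ^ (-(1 / p)) := by
  set K : ℝ := 2 * (R ^ (p + 1) / p) + ((p + 1) * R ^ p + p) / p * R + R ^ (p + 1) / p * R with hK
  refine ⟨2 ^ (1 / p) + K * (2 / p) ^ (1 / p), fun t ht D ψ ψ' hψ hψ'c hA hB ↦ ?_⟩
  have hD : 0 ≤ D := (norm_nonneg _).trans (hA 0)
  have hR0 : 0 < R := by linarith
  have hK0 : 0 ≤ K := by positivity
  have ht0 : 0 < t := (Real.exp_pos 2).trans_le ht
  have hl : 2 ≤ Real.log t := (Real.le_log_iff_exp_le ht0).2 ht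
  set L := Real.log t with hL
  have hL0 : 0 < L := by linarith
  set a : ℝ := (L / 2) ^ (-(1 / p)) with ha
  have ha0 : 0 < a := by positivity
  have ha1 : a ≤ 1 := Real.rpow_le_one_of_one_le_of_nonpos (by linarith)
    (neg_nonpos.2 (by positivity))
  have haR : a ≤ R := ha1.trans hR
  have hap : a ^ p = (L / 2)⁻¹ := by
    rw [ha, ← Real.rpow_mul (by positivity), neg_mul, one_div, inv_mul_cancel₀ hp.ne',
      Real.rpow_neg_one]
  have ha2 : a = 2 ^ (1 / p) * L ^ (-(1 / p)) := by
    rw [ha, Real.div_rpow hL0.le zero_le_two, Real.rpow_neg zero_le_two, div_inv_eq_mul, mul_comm]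
  have hpos : ∀ x ∈ Set.Icc a R, 0 < x := fun x hx ↦ ha0.trans_le hx.1
  set u : ℝ → ℝ := fun x ↦ Real.exp (1 / x ^ p) with hu
  have hexp : ∀ x ∈ Set.Icc a R, u x ≤ t ^ (1 / 2 : ℝ) := by
    intro x hx
    rw [Real.rpow_def_of_pos ht0, hu]
    refine Real.exp_le_exp.2 ?_
    have h1 : a ^ p ≤ x ^ p := Real.rpow_le_rpow ha0.le hx.1 hp.le
    have h2 : 1 / x ^ p ≤ 1 / a ^ p := one_div_le_one_div_of_le (by positivity) h1
    rw [hap, one_div (L / 2)⁻¹, inv_inv] at h2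
    linarith
  have hxp : ∀ x ∈ Set.Icc a R, x ^ p ≤ R ^ p := fun x hx ↦
    Real.rpow_le_rpow (hpos x hx).le hx.2 hp.le
  have hdiv : ∀ x ∈ Set.Icc a R,
      HasDerivAt (fun x : ℝ ↦ 1 / x ^ p) (-(p * x ^ (p - 1)) / (x ^ p) ^ 2) x := by
    intro x hx
    have hx0 := hpos x hx
    have h1 := (Real.hasDerivAt_rpow_const (p := p) (Or.inl hx0.ne')).inv
      (Real.rpow_pos_of_pos hx0 p).ne'
    simp only [one_div]
    exact h1
  set h' : ℝ → ℝ := fun x ↦ t * (Real.exp (-1 / x ^ p) * (p * x ^ (p - 1) / (x ^ p) ^ 2)) with hh'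
  set w : ℝ → ℝ := fun x ↦ (t * p)⁻¹ * (x ^ (p + 1) * u x) with hw
  set w' : ℝ → ℝ := fun x ↦ (t * p)⁻¹ * (((p + 1) * x ^ p - p) * u x) with hw'
  have hwd : ∀ x ∈ Set.Icc a R, HasDerivAt w (w' x) x := by
    intro x hx
    have hx0 := hpos x hx
    have h1 := (Real.hasDerivAt_rpow_const (p := p + 1) (Or.inl hx0.ne')).mul (hdiv x hx).exp
    refine (h1.const_mul (t * p)⁻¹).congr_deriv ?_
    simp only [hw', hu, add_sub_cancel_right]
    rw [Real.rpow_add hx0, Real.rpow_sub hx0, Real.rpow_one]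
    have := Real.rpow_pos_of_pos hx0 p
    field_simp
    ring
  have hS : t ^ (1 / 2 : ℝ) * t ^ (1 / 2 : ℝ) = t := by
    rw [← Real.rpow_add ht0]
    norm_num
  set S : ℝ := t ^ (1 / 2 : ℝ) with hSdef
  have hS0 : 0 < S := by positivity
  have htS : t⁻¹ * S = S⁻¹ := by
    rw [← hS]
    field_simp
  have hw'b : ∀ x ∈ Set.Icc a R, |w' x| ≤ ((p + 1) * R ^ p + p) / p * S⁻¹ := by
    intro x hx
    have hx0 := hpos x hx
    have h1 : |(p + 1) * x ^ p - p| ≤ (p + 1) * R ^ p + p := by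
      have h2 := hxp x hx
      have h3 : 0 ≤ x ^ p := by positivity
      rw [abs_le]
      constructor <;> nlinarith
    have h4 : 0 < u x := Real.exp_pos _
    calc |w' x| = (t * p)⁻¹ * (|(p + 1) * x ^ p - p| * u x) := by
          simp only [hw']
          rw [abs_mul, abs_mul, abs_of_pos h4, abs_of_pos (by positivity : 0 < (t * p)⁻¹)]
      _ ≤ (t * p)⁻¹ * (((p + 1) * R ^ p + p) * S) := by
          gcongr
          exact hexp x hx
      _ = _ := by
          rw [← htS, mul_inv]
          ring
  have key := norm_integral_exp_mul_le_of_inv_deriv (M := R ^ (p + 1) / p * S⁻¹)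
    (N := ((p + 1) * R ^ p + p) / p * S⁻¹ * R) haR
    (h := fun x ↦ t * Real.exp (-1 / x ^ p)) (h' := h') (w := w) (w' := w')
    (fun x hx ↦ by
      have h1 := ((hdiv x hx).neg.exp).const_mul t
      simp only [Pi.neg_apply, ← neg_div, neg_neg] at h1
      exact h1)
    hwd hψ
    (fun x hx ↦ by
      have hx0 := hpos x hx
      have h1 : Real.exp (-1 / x ^ p) = (Real.exp (1 / x ^ p))⁻¹ := by
        rw [← Real.exp_neg, neg_div]
      simp only [hw, hh', hu, h1]
      rw [Real.rpow_add hx0, Real.rpow_sub hx0, Real.rpow_one]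
      have := Real.rpow_pos_of_pos hx0 p
      have := Real.exp_pos (1 / x ^ p)
      field_simp)
    (by
      have h1 : ContinuousOn (fun x : ℝ ↦ x ^ p) (Set.Icc a R) :=
        (Real.continuous_rpow_const hp.le).continuousOn
      have h2 : ContinuousOn u (Set.Icc a R) := fun x hx ↦
        (hdiv x hx).exp.continuousAt.continuousWithinAt
      fun_prop)
    hψ'c
    (fun x hx ↦ by
      have hx0 := hpos x hx
      have h4 : 0 < u x := Real.exp_pos _
      calc |w x| = (t * p)⁻¹ * (x ^ (p + 1) * u x) := abs_of_pos (by positivity)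
        _ ≤ (t * p)⁻¹ * (R ^ (p + 1) * S) := by
          gcongr
          · exact hx.2
          · exact hexp x hx
        _ = _ := by
          rw [← htS, mul_inv]
          ring)
    (by
      refine (le_abs_self _).trans ?_
      rw [← Real.norm_eq_abs]
      refine (intervalIntegral.norm_integral_le_of_norm_le_const
        (C := ((p + 1) * R ^ p + p) / p * S⁻¹) fun x hx ↦ ?_).trans ?_
      · rw [Set.uIoc_of_le haR] at hx
        rw [Real.norm_eq_abs, abs_abs]
        exact hw'b x (Set.Ioc_subset_Icc_self hx)
      · rw [abs_of_nonneg (by linarith)]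
        gcongr
        linarith)
    hA hB
  have hψc : Continuous ψ := continuous_iff_continuousAt.2 fun x ↦ (hψ x).continuousAt
  have hmeas : Measurable fun x : ℝ ↦
      Complex.exp (((t * Real.exp (-1 / x ^ p) : ℝ) : ℂ) * Complex.I) := by fun_prop
  have hPint : ∀ b c : ℝ, IntervalIntegrable (fun x : ℝ ↦
      Complex.exp (((t * Real.exp (-1 / x ^ p) : ℝ) : ℂ) * Complex.I) * ψ x) volume b c := by
    intro b c
    refine (intervalIntegrable_const (c := D)).mono_fun
      (hmeas.mul hψc.measurable).aestronglyMeasurable (Eventually.of_forall fun x ↦ ?_)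
    simp only [norm_mul, Complex.norm_exp_ofReal_mul_I, one_mul, Real.norm_of_nonneg hD]
    exact hA x
  rw [← intervalIntegral.integral_add_adjacent_intervals (hPint 0 a) (hPint a R)]
  have hfirst := intervalIntegral.norm_integral_le_of_norm_le_const (a := 0) (b := a) (C := D)
    (f := fun x : ℝ ↦ Complex.exp (((t * Real.exp (-1 / x ^ p) : ℝ) : ℂ) * Complex.I) * ψ x)
    fun x _ ↦ by
      rw [norm_mul, Complex.norm_exp_ofReal_mul_I, one_mul]
      exact hA x
  rw [sub_zero, abs_of_pos ha0] at hfirst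
  have hSL : S⁻¹ ≤ (2 / p) ^ (1 / p) * L ^ (-(1 / p)) := by
    have h1 : L ≤ t ^ (p / 2) / (p / 2) := Real.log_le_rpow_div ht0.le (by positivity)
    have h2 : L ^ (1 / p) ≤ (2 / p * t ^ (p / 2)) ^ (1 / p) := by
      refine Real.rpow_le_rpow hL0.le (h1.trans_eq ?_) (by positivity)
      field_simp
    rw [Real.mul_rpow (by positivity) (by positivity), ← Real.rpow_mul ht0.le,
      show p / 2 * (1 / p) = 1 / 2 by field_simp] at h2
    rw [Real.rpow_neg hL0.le, ← div_eq_mul_inv, le_div_iff₀ (by positivity),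
      inv_mul_le_iff₀ hS0, mul_comm]
    exact h2
  calc _ ≤ _ := norm_add_le _ _
    _ ≤ D * (2 ^ (1 / p) * L ^ (-(1 / p))) + K * D * S⁻¹ := by
        refine add_le_add (hfirst.trans_eq (by rw [ha2])) (key.trans ?_)
        have h1 : 0 ≤ R ^ (p + 1) / p * S⁻¹ * D * a := by positivity
        rw [hK]
        linarith
    _ ≤ D * (2 ^ (1 / p) * L ^ (-(1 / p))) + K * D * ((2 / p) ^ (1 / p) * L ^ (-(1 / p))) := by
        gcongr
    _ = _ := by ring

theorem HasCompactSupport.exists_one_le_forall_abs_lt {φ : ℝ × ℝ → ℝ}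
    (hφ : HasCompactSupport φ) :
    ∃ R : ℝ, 1 ≤ R ∧ ∀ z, φ z ≠ 0 → |z.1| < R ∧ |z.2| < R := by
  obtain ⟨r, hr⟩ := hφ.isCompact.isBounded.exists_norm_le
  refine ⟨max r 0 + 1, by simp, fun z hz ↦ ?_⟩
  have h1 : ‖z‖ ≤ r := hr z (subset_tsupport _ hz)
  have h2 : ‖z‖ < max r 0 + 1 := by linarith [le_max_left r 0]
  exact ⟨(norm_fst_le z).trans_lt h2, (norm_snd_le z).trans_lt h2⟩

theorem integral_eq_intervalIntegral_of_forall_abs_lt {F : ℝ → ℂ} {R : ℝ}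
    (h : ∀ y, F y ≠ 0 → |y| < R) : ∫ y, F y = ∫ y in -R..R, F y := by
  refine (intervalIntegral.integral_eq_integral_of_support_subset fun y hy ↦ ?_).symm
  have := abs_lt.1 (h y hy)
  exact ⟨this.1, this.2.le⟩

/-- Decay of the one-dimensional integrals with phase `t y ^ q`, uniformly over the slices of a
two-dimensional amplitude. -/
theorem exists_norm_integral_exp_pow_mul_slice_le {q : ℕ} (hq : 2 ≤ q) {φ : ℝ × ℝ → ℝ}
    (hφ : ContDiff ℝ 1 φ) (hφc : HasCompactSupport φ) :
    ∃ C : ℝ, ∀ t ≥ (1 : ℝ), ∀ x : ℝ,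
      ‖∫ y : ℝ, Complex.exp (((t * y ^ q : ℝ) : ℂ) * Complex.I) * (φ (x, y) : ℂ)‖ ≤
        C * t ^ (-(1 / (q : ℝ))) := by
  obtain ⟨R, hR, hsupp⟩ := hφc.exists_one_le_forall_abs_lt
  obtain ⟨A, hA⟩ := hφc.exists_bound_of_continuous hφ.continuous
  have hφ' : Continuous fun z ↦ fderiv ℝ φ z (0, 1) :=
    (hφ.continuous_fderiv one_ne_zero).clm_apply continuous_const
  obtain ⟨B, hB⟩ := (hφc.fderiv_apply ℝ (0, 1)).exists_bound_of_continuous hφ'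
  refine ⟨2 * A + 2 * (3 * A + B * R), fun t ht x ↦ ?_⟩
  have hA0 : 0 ≤ A := (norm_nonneg _).trans (hA 0)
  have ht0 : 0 < t := by linarith
  have hq0 : (q : ℝ) ≠ 0 := by positivity
  set δ : ℝ := t ^ (-(1 / (q : ℝ))) with hδ
  have hδ0 : 0 < δ := by positivity
  have hδ1 : δ ≤ 1 := Real.rpow_le_one_of_one_le_of_nonpos ht (neg_nonpos.2 (by positivity))
  have hδR : δ ≤ R := hδ1.trans hR
  have hδq : t * δ ^ (q - 1) = δ⁻¹ := by
    have h1 : δ ^ q = t⁻¹ := by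
      rw [hδ, ← Real.rpow_natCast, ← Real.rpow_mul ht0.le, neg_mul, one_div,
        inv_mul_cancel₀ hq0, Real.rpow_neg_one]
    have h2 : δ ^ (q - 1) * δ = t⁻¹ := by rw [← h1, ← pow_succ, Nat.sub_add_cancel (by omega)]
    exact eq_inv_of_mul_eq_one_left (by rw [mul_assoc, h2, mul_inv_cancel₀ ht0.ne'])
  have hdφ : ∀ y, HasDerivAt (fun y ↦ (φ (x, y) : ℂ)) ((fderiv ℝ φ (x, y) (0, 1) : ℝ) : ℂ) y := by
    intro y
    have h1 : HasDerivAt (fun y : ℝ ↦ (x, y)) ((0 : ℝ), (1 : ℝ)) y :=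
      (hasDerivAt_const y x).prodMk (hasDerivAt_id y)
    exact (((hφ.differentiable one_ne_zero) (x, y)).hasFDerivAt.comp_hasDerivAt y h1).ofReal_comp
  have hφ'x : Continuous fun y ↦ ((fderiv ℝ φ (x, y) (0, 1) : ℝ) : ℂ) :=
    Complex.continuous_ofReal.comp (hφ'.comp (by fun_prop : Continuous fun y : ℝ ↦ (x, y)))
  set F : ℝ → ℂ := fun y ↦ Complex.exp (((t * y ^ q : ℝ) : ℂ) * Complex.I) * (φ (x, y) : ℂ) with hF
  have hFc : Continuous F := by
    have := hφ.continuous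
    fun_prop
  have hFA : ∀ y, ‖F y‖ ≤ A := fun y ↦ by
    simp only [hF, norm_mul, Complex.norm_exp_ofReal_mul_I, one_mul, Complex.norm_real]
    exact hA _
  have hpos : ‖∫ y in δ..R, F y‖ ≤ (3 * A + B * R) * δ := by
    have h1 := norm_integral_exp_pow_mul_le hq ht0.ne' hδ0 hδR hdφ hφ'x
      (fun y ↦ by rw [Complex.norm_real]; exact hA _)
      (fun y ↦ by rw [Complex.norm_real]; exact hB _)
    rwa [abs_of_pos ht0, hδq, div_inv_eq_mul] at h1
  have hneg : ‖∫ y in -R..-δ, F y‖ ≤ (3 * A + B * R) * δ := by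
    have h1 := norm_integral_exp_pow_mul_le hq (s := t * (-1) ^ q) (δ := δ) (R := R)
      (A := A) (B := B) (ψ := fun y ↦ (φ (x, -y) : ℂ))
      (ψ' := fun y ↦ -((fderiv ℝ φ (x, -y) (0, 1) : ℝ) : ℂ))
      (by positivity) hδ0 hδR
      (fun y ↦ ((hdφ (-y)).scomp y (hasDerivAt_neg y)).congr_deriv (by simp))
      (hφ'x.comp continuous_neg).neg
      (fun y ↦ by rw [Complex.norm_real]; exact hA _)
      (fun y ↦ by rw [norm_neg, Complex.norm_real]; exact hB _)
    rw [abs_mul, abs_pow, abs_neg, abs_one, one_pow, mul_one, abs_of_pos ht0, hδq,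
      div_inv_eq_mul] at h1
    rw [← intervalIntegral.integral_comp_neg]
    convert! h1 using 5 with y
    simp only [neg_pow y q, mul_assoc]
  have hmid : ‖∫ y in -δ..δ, F y‖ ≤ 2 * A * δ := by
    refine (intervalIntegral.norm_integral_le_of_norm_le_const fun y _ ↦ hFA y).trans_eq ?_
    rw [abs_of_pos (by linarith)]
    ring
  have hi : ∀ a b : ℝ, IntervalIntegrable F volume a b := fun a b ↦ hFc.intervalIntegrable a b
  rw [integral_eq_intervalIntegral_of_forall_abs_lt (R := R) fun y hy ↦
      (hsupp (x, y) fun h0 ↦ hy (by simp [h0])).2,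
    ← intervalIntegral.integral_add_adjacent_intervals (hi (-R) (-δ)) (hi (-δ) R),
    ← intervalIntegral.integral_add_adjacent_intervals (hi (-δ) δ) (hi δ R)]
  have h1 := norm_add_le (∫ y in -R..-δ, F y) ((∫ y in -δ..δ, F y) + ∫ y in δ..R, F y)
  have h2 := norm_add_le (∫ y in -δ..δ, F y) (∫ y in δ..R, F y)
  linarith

/-- Differentiation under the integral sign of the slice integrals. -/
theorem hasDerivAt_integral_mul_slice {e : ℝ → ℂ} (he : Continuous e) {φ : ℝ × ℝ → ℝ}
    (hφ : ContDiff ℝ 1 φ) (hφc : HasCompactSupport φ) :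
    (∀ x, HasDerivAt (fun x ↦ ∫ y : ℝ, e y * (φ (x, y) : ℂ))
      (∫ y : ℝ, e y * ((fderiv ℝ φ (x, y) (1, 0) : ℝ) : ℂ)) x) ∧
    Continuous fun x ↦ ∫ y : ℝ, e y * ((fderiv ℝ φ (x, y) (1, 0) : ℝ) : ℂ) := by
  have hφ' : Continuous fun z ↦ fderiv ℝ φ z (1, 0) :=
    (hφ.continuous_fderiv one_ne_zero).clm_apply continuous_const
  have hφ'c : HasCompactSupport fun z ↦ fderiv ℝ φ z (1, 0) := hφc.fderiv_apply ℝ (1, 0)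
  obtain ⟨R, -, hsupp⟩ := hφc.exists_one_le_forall_abs_lt
  obtain ⟨R', -, hsupp'⟩ := hφ'c.exists_one_le_forall_abs_lt
  obtain ⟨B, hB⟩ := hφ'c.exists_bound_of_continuous hφ'
  set T : ℝ := max R R' with hT
  have h1 : ∀ x, ∫ y : ℝ, e y * (φ (x, y) : ℂ) = ∫ y in -T..T, e y * (φ (x, y) : ℂ) := fun x ↦
    integral_eq_intervalIntegral_of_forall_abs_lt fun y hy ↦
      (hsupp (x, y) fun h0 ↦ hy (by simp [h0])).2.trans_le (le_max_left _ _)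
  have h2 : ∀ x, ∫ y : ℝ, e y * ((fderiv ℝ φ (x, y) (1, 0) : ℝ) : ℂ) =
      ∫ y in -T..T, e y * ((fderiv ℝ φ (x, y) (1, 0) : ℝ) : ℂ) := fun x ↦
    integral_eq_intervalIntegral_of_forall_abs_lt fun y hy ↦
      (hsupp' (x, y) fun h0 ↦ hy (by simp [h0])).2.trans_le (le_max_right _ _)
  have hφcont := hφ.continuous
  have hcont' : Continuous fun z : ℝ × ℝ ↦ e z.2 * ((fderiv ℝ φ z (1, 0) : ℝ) : ℂ) := by fun_prop
  simp only [h1, h2]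
  refine ⟨fun x ↦ ?_, intervalIntegral.continuous_parametric_intervalIntegral_of_continuous'
    hcont' _ _⟩
  have hslice : ∀ x : ℝ, Continuous fun y : ℝ ↦ e y * (φ (x, y) : ℂ) := fun x ↦ by fun_prop
  refine (intervalIntegral.hasDerivAt_integral_of_dominated_loc_of_deriv_le
    (bound := fun y ↦ ‖e y‖ * B) (s := Set.univ)
    (F' := fun x y ↦ e y * ((fderiv ℝ φ (x, y) (1, 0) : ℝ) : ℂ)) univ_mem
    (Eventually.of_forall fun x ↦ (hslice x).aestronglyMeasurable)
    ((hslice x).intervalIntegrable _ _)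
    (hcont'.comp (by fun_prop : Continuous fun y : ℝ ↦ (x, y))).aestronglyMeasurable
    (Eventually.of_forall fun y _ x _ ↦ ?_)
    (Continuous.intervalIntegrable (by fun_prop) _ _)
    (Eventually.of_forall fun y _ x _ ↦ ?_)).2
  · rw [norm_mul, Complex.norm_real]
    exact mul_le_mul_of_nonneg_left (hB _) (norm_nonneg _)
  · have h3 : HasDerivAt (fun x : ℝ ↦ (x, y)) ((1 : ℝ), (0 : ℝ)) x :=
      (hasDerivAt_id x).prodMk (hasDerivAt_const x y)
    exact ((((hφ.differentiable one_ne_zero) (x, y)).hasFDerivAt.comp_hasDerivAt x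
      h3).ofReal_comp).const_mul (e y)

theorem stmt2 (p : ℝ) (hp : 0 < p) (q : ℕ) (hq : 2 ≤ q)
    (φ : ℝ × ℝ → ℝ) (hφ : ContDiff ℝ (⊤ : ℕ∞) φ) (hφc : HasCompactSupport φ) :
    ∃ C > (0 : ℝ), ∃ t₀ > (1 : ℝ), ∀ t ≥ t₀,
      ‖∫ x : ℝ × ℝ, Complex.exp (Complex.I * (t : ℂ) * ((phase p q x : ℝ) : ℂ)) *
          ((φ x : ℝ) : ℂ)‖ ≤
        C * t ^ (-(1 / (q : ℝ))) * (Real.log t) ^ (-(1 / p)) := by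
  have hφ1 : ContDiff ℝ 1 φ := hφ.of_le (by exact_mod_cast le_top)
  have hφ'1 : ContDiff ℝ 1 fun z ↦ fderiv ℝ φ z (1, 0) :=
    (hφ.fderiv_right (m := 1) (WithTop.coe_le_coe.2 (le_top : (1 + 1 : ℕ∞) ≤ ⊤))).clm_apply
      contDiff_const
  have hφ'c : HasCompactSupport fun z ↦ fderiv ℝ φ z (1, 0) := hφc.fderiv_apply ℝ (1, 0)
  obtain ⟨R, hR, hsupp⟩ := hφc.exists_one_le_forall_abs_lt
  obtain ⟨C₀, hC₀⟩ := exists_norm_integral_exp_pow_mul_slice_le hq hφ1 hφc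
  obtain ⟨C₁, hC₁⟩ := exists_norm_integral_exp_pow_mul_slice_le hq hφ'1 hφ'c
  obtain ⟨C₂, hC₂⟩ := exists_norm_integral_exp_exp_neg_rpow_mul_le hp hR
  refine ⟨max (2 * C₂ * max C₀ C₁) 1, by positivity, Real.exp 2,
    Real.one_lt_exp_iff.2 two_pos, fun t ht ↦ ?_⟩
  have ht1 : 1 ≤ t := (Real.one_le_exp zero_le_two).trans ht
  have ht0 : 0 < t := by linarith
  have hlog : 0 ≤ Real.log t := Real.log_nonneg ht1
  set E : ℝ → ℂ := fun y ↦ Complex.exp (((t * y ^ q : ℝ) : ℂ) * Complex.I) with hE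
  have hEc : Continuous E := by fun_prop
  set G : ℝ → ℂ := fun x ↦ ∫ y : ℝ, E y * (φ (x, y) : ℂ) with hG
  set G' : ℝ → ℂ := fun x ↦ ∫ y : ℝ, E y * ((fderiv ℝ φ (x, y) (1, 0) : ℝ) : ℂ) with hG'
  obtain ⟨hGd, hG'cont⟩ := hasDerivAt_integral_mul_slice hEc hφ1 hφc
  set D : ℝ := max C₀ C₁ * t ^ (-(1 / (q : ℝ))) with hD
  have hGD : ∀ x, ‖G x‖ ≤ D := fun x ↦ (hC₀ t ht1 x).trans
    (mul_le_mul_of_nonneg_right (le_max_left _ _) (by positivity))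
  have hG'D : ∀ x, ‖G' x‖ ≤ D := fun x ↦ (hC₁ t ht1 x).trans
    (mul_le_mul_of_nonneg_right (le_max_right _ _) (by positivity))
  have hGcont : Continuous G := continuous_iff_continuousAt.2 fun x ↦ (hGd x).continuousAt
  set g : ℝ → ℝ := fun x ↦ if x = 0 then 0 else Real.exp (-1 / |x| ^ p) with hg
  have hgm : Measurable g := Measurable.ite (measurableSet_singleton 0) measurable_const
    (by fun_prop)
  set P : ℝ → ℂ := fun x ↦ Complex.exp (((t * g x : ℝ) : ℂ) * Complex.I) with hP
  have hPm : Measurable P := by fun_prop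
  have hPn : ∀ x, ‖P x‖ = 1 := fun x ↦ Complex.norm_exp_ofReal_mul_I _
  have hfactor : ∀ z : ℝ × ℝ, Complex.exp (Complex.I * (t : ℂ) * ((phase p q z : ℝ) : ℂ)) *
      ((φ z : ℝ) : ℂ) = P z.1 * (E z.2 * (φ z : ℂ)) := by
    intro z
    rw [← mul_assoc, hP, hE, ← Complex.exp_add]
    congr 2
    simp only [phase, hg]
    push_cast
    ring
  have hPint : Integrable fun z : ℝ × ℝ ↦ P z.1 * (E z.2 * (φ z : ℂ)) := by
    have h1 : Integrable fun z : ℝ × ℝ ↦ E z.2 * (φ z : ℂ) := by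
      refine Continuous.integrable_of_hasCompactSupport (by have := hφ.continuous; fun_prop) ?_
      exact (hφc.comp_left Complex.ofReal_zero).mul_left
    exact h1.bdd_mul (c := 1) (hPm.comp measurable_fst).aestronglyMeasurable
      (Eventually.of_forall fun z ↦ (hPn z.1).le)
  have hPG : ∀ a b : ℝ, IntervalIntegrable (fun x ↦ P x * G x) volume a b := by
    intro a b
    refine (hGcont.intervalIntegrable a b).mono_fun
      (hPm.mul hGcont.measurable).aestronglyMeasurable (Eventually.of_forall fun x ↦ ?_)
    simp [hPn]
  have hPeq : ∀ x : ℝ, 0 < x →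
      P x = Complex.exp (((t * Real.exp (-1 / x ^ p) : ℝ) : ℂ) * Complex.I) := fun x hx ↦ by
    simp only [hP, hg, if_neg hx.ne', abs_of_pos hx]
  have hPneg : ∀ x, P (-x) = P x := fun x ↦ by simp only [hP, hg, neg_eq_zero, abs_neg]
  have hhalf : ∀ ψ : ℝ → ℂ, ∫ x in (0 : ℝ)..R, P x * ψ x = ∫ x in (0 : ℝ)..R,
      Complex.exp (((t * Real.exp (-1 / x ^ p) : ℝ) : ℂ) * Complex.I) * ψ x := fun ψ ↦ by
    refine intervalIntegral.integral_congr_ae (Eventually.of_forall fun x hx ↦ ?_)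
    rw [Set.uIoc_of_le (by linarith)] at hx
    rw [hPeq x hx.1]
  have hpos : ‖∫ x in (0 : ℝ)..R, P x * G x‖ ≤ C₂ * D * Real.log t ^ (-(1 / p)) := by
    rw [hhalf]
    exact hC₂ t ht hGd hG'cont hGD hG'D
  have hneg : ‖∫ x in -R..0, P x * G x‖ ≤ C₂ * D * Real.log t ^ (-(1 / p)) := by
    have h1 : ∫ x in -R..0, P x * G x = ∫ x in (0 : ℝ)..R, P x * G (-x) := by
      rw [← neg_zero, ← intervalIntegral.integral_comp_neg, neg_zero]
      simp only [hPneg]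
    rw [h1, hhalf]
    exact hC₂ t ht (ψ' := fun x ↦ -G' (-x))
      (fun x ↦ ((hGd (-x)).scomp x (hasDerivAt_neg x)).congr_deriv (by simp [hG']))
      (hG'cont.comp continuous_neg).neg (fun x ↦ hGD _) (fun x ↦ by rw [norm_neg]; exact hG'D _)
  have hmain : ∫ x : ℝ × ℝ, Complex.exp (Complex.I * (t : ℂ) * ((phase p q x : ℝ) : ℂ)) *
      ((φ x : ℝ) : ℂ) = (∫ x in -R..0, P x * G x) + ∫ x in (0 : ℝ)..R, P x * G x := by
    simp only [hfactor]
    rw [intervalIntegral.integral_add_adjacent_intervals (hPG _ _) (hPG _ _),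
      Measure.volume_eq_prod, integral_prod _ hPint]
    simp only [integral_const_mul]
    refine integral_eq_intervalIntegral_of_forall_abs_lt fun x hx ↦ ?_
    by_contra hxR
    refine hx ?_
    have h0 : ∀ y, φ (x, y) = 0 := fun y ↦ by
      by_contra h
      exact hxR (hsupp (x, y) h).1
    simp [h0]
  rw [hmain]
  calc _ ≤ _ := norm_add_le _ _
    _ ≤ 2 * C₂ * max C₀ C₁ * t ^ (-(1 / (q : ℝ))) * Real.log t ^ (-(1 / p)) := by
        rw [hD] at hpos hneg
        linarith
    _ ≤ _ := by
        gcongr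
        exact le_max_left _ _
end

section
/- Let p > 0 be a real number and let ψ : ℝ → ℝ be a smooth compactly supported function. Then lim_{t→∞} (log t)^{1/p} · L⁽¹⁾(t;ψ) = ψ(0). -/
open MeasureTheory Filter

/-- `L⁽¹⁾(t;ψ) = ∫₀^{(log t)^{-1/p}} e^{i t exp(-1/x^p)} ψ(x) dx`. -/
noncomputable def Lone (p t : ℝ) (ψ : ℝ → ℝ) : ℂ :=
  ∫ x in Set.Ioo (0 : ℝ) ((Real.log t) ^ (-(1 / p))),
    Complex.exp (Complex.I * (t : ℂ) * ((Real.exp (-1 / x ^ p) : ℝ) : ℂ)) * ((ψ x : ℝ) : ℂ)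

/-- Rescaling by `(log t)^{-1/p}` turns the domain of `Lone` into the unit interval. -/
lemma rpow_mul_Lone_eq (p : ℝ) {t : ℝ} (ht : 1 < t) (ψ : ℝ → ℝ) :
    (((Real.log t) ^ (1 / p) : ℝ) : ℂ) * Lone p t ψ =
      ∫ u in (0 : ℝ)..1,
        Complex.exp (Complex.I * (t : ℂ) *
          ((Real.exp (-1 / (Real.log t ^ (-(1 / p)) * u) ^ p) : ℝ) : ℂ)) *
          ((ψ (Real.log t ^ (-(1 / p)) * u) : ℝ) : ℂ) := by
  have hl : 0 < Real.log t := Real.log_pos ht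
  have hh : 0 < Real.log t ^ (-(1 / p)) := Real.rpow_pos_of_pos hl _
  have key := intervalIntegral.integral_comp_mul_left (a := 0) (b := 1) (fun x : ℝ =>
    Complex.exp (Complex.I * (t : ℂ) * ((Real.exp (-1 / x ^ p) : ℝ) : ℂ)) * ((ψ x : ℝ) : ℂ))
    hh.ne'
  rw [key, mul_zero, mul_one, intervalIntegral.integral_of_le hh.le,
    integral_Ioc_eq_integral_Ioo, ← Real.rpow_neg hl.le, neg_neg, Complex.real_smul, Lone]

/-- In the rescaled variable `u ∈ (0, 1)` the phase tends to zero. -/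
lemma tendsto_mul_exp_neg_one_div_rpow {p u : ℝ} (hp : 0 < p) (hu0 : 0 < u) (hu1 : u < 1) :
    Tendsto (fun t : ℝ => t * Real.exp (-1 / (Real.log t ^ (-(1 / p)) * u) ^ p))
      atTop (nhds 0) := by
  have hup : 0 < u ^ p := Real.rpow_pos_of_pos hu0 p
  have hc : 1 - (u ^ p)⁻¹ < 0 := by
    have := (one_lt_inv₀ hup).2 (Real.rpow_lt_one hu0.le hu1 hp)
    linarith
  have h1 : Tendsto (fun t : ℝ => Real.exp (Real.log t * (1 - (u ^ p)⁻¹))) atTop (nhds 0) :=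
    Real.tendsto_exp_atBot.comp (Real.tendsto_log_atTop.atTop_mul_const_of_neg hc)
  refine h1.congr' ?_
  filter_upwards [eventually_gt_atTop 1] with t ht
  have hl : 0 < Real.log t := Real.log_pos ht
  have hpow : (Real.log t ^ (-(1 / p)) * u) ^ p = (Real.log t)⁻¹ * u ^ p := by
    rw [Real.mul_rpow (Real.rpow_nonneg hl.le _) hu0.le, ← Real.rpow_mul hl.le, neg_mul,
      one_div_mul_cancel hp.ne', Real.rpow_neg_one]
  conv_rhs => enter [1]; rw [← Real.exp_log (zero_lt_one.trans ht)]
  rw [hpow, ← Real.exp_add]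
  congr 1
  field_simp
  ring

theorem stmt3 (p : ℝ) (hp : 0 < p) (ψ : ℝ → ℝ)
    (hψ : ContDiff ℝ (⊤ : ℕ∞) ψ) (hψc : HasCompactSupport ψ) :
    Tendsto (fun t : ℝ => (((Real.log t) ^ (1 / p) : ℝ) : ℂ) * Lone p t ψ)
      atTop (nhds ((ψ 0 : ℝ) : ℂ)) := by
  have hcont : Continuous ψ := hψ.continuous
  obtain ⟨C, hC⟩ := hcont.bounded_above_of_compact_support hψc
  have hscale : Tendsto (fun t : ℝ => Real.log t ^ (-(1 / p))) atTop (nhds 0) :=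
    (tendsto_rpow_neg_atTop (one_div_pos.2 hp)).comp Real.tendsto_log_atTop
  have hlim : Tendsto (fun t : ℝ => ∫ u in (0 : ℝ)..1,
        Complex.exp (Complex.I * (t : ℂ) *
          ((Real.exp (-1 / (Real.log t ^ (-(1 / p)) * u) ^ p) : ℝ) : ℂ)) *
          ((ψ (Real.log t ^ (-(1 / p)) * u) : ℝ) : ℂ))
      atTop (nhds (∫ _ in (0 : ℝ)..1, ((ψ 0 : ℝ) : ℂ))) := by
    refine intervalIntegral.tendsto_integral_filter_of_dominated_convergence (fun _ => C)
      (Eventually.of_forall fun t => ?_)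
      (Eventually.of_forall fun t => Eventually.of_forall fun u _ => ?_)
      intervalIntegrable_const ?_
    · have := hcont.measurable
      exact Measurable.aestronglyMeasurable (by fun_prop)
    · have harg : Complex.I * (t : ℂ) *
          ((Real.exp (-1 / (Real.log t ^ (-(1 / p)) * u) ^ p) : ℝ) : ℂ) =
          ((t * Real.exp (-1 / (Real.log t ^ (-(1 / p)) * u) ^ p) : ℝ) : ℂ) * Complex.I := by
        push_cast
        ring
      rw [norm_mul, harg, Complex.norm_exp_ofReal_mul_I, one_mul, Complex.norm_real]
      exact hC _
    · filter_upwards [Measure.ae_ne volume (1 : ℝ)] with u hu1 hu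
      rw [Set.uIoc_of_le zero_le_one] at hu
      have hphase := tendsto_mul_exp_neg_one_div_rpow hp hu.1 (lt_of_le_of_ne hu.2 hu1)
      have hexp : Tendsto (fun t : ℝ => Complex.exp (Complex.I * (t : ℂ) *
          ((Real.exp (-1 / (Real.log t ^ (-(1 / p)) * u) ^ p) : ℝ) : ℂ))) atTop (nhds 1) := by
        have h := (Complex.continuous_exp.tendsto _).comp
          (((Complex.continuous_ofReal.tendsto _).comp hphase).const_mul Complex.I)
        simpa [Function.comp_def, mul_assoc] using h
      have hamp : Tendsto (fun t : ℝ => ((ψ (Real.log t ^ (-(1 / p)) * u) : ℝ) : ℂ)) atTop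
          (nhds ((ψ 0 : ℝ) : ℂ)) := by
        refine ((Complex.continuous_ofReal.comp hcont).tendsto 0).comp ?_
        simpa using hscale.mul_const u
      simpa using hexp.mul hamp
  simp only [intervalIntegral.integral_const, sub_zero, one_smul] at hlim
  refine hlim.congr' ?_
  filter_upwards [eventually_gt_atTop 1] with t ht
  exact (rpow_mul_Lone_eq p ht ψ).symm
end
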